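/- arXiv:0902.2274 — 3 statements merged into one kernel-verified Lean document; each statement's English description precedes it below -/
import Mathlib

section
/- Fix an integer a ≥ 2 and an integer m ≥ 1. The number of pyramids of size m equals the binomial coefficient C(a·m − 1, m − 1). -/
/-- A pyramid made of horizontal pieces of length `a`: a finite set of pairs
`(s, h)` (the piece covering `]s, s+a[` at level `h`) such that `(0,0)` is the
unique bottom piece, pieces at the same level overlap nowhere (are at horizontal
distance at least `a`), and every piece at level `h ≥ 1` rests on a piece at
level `h - 1` (horizontal distance at most `a - 1`). -/
def IsPyramid (a : ℕ) (P : Finset (ℤ × ℕ)) : Prop :=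
  ((0 : ℤ), (0 : ℕ)) ∈ P ∧
  (∀ p ∈ P, p.2 = 0 → p = ((0 : ℤ), (0 : ℕ))) ∧
  (∀ p ∈ P, ∀ q ∈ P, p.2 = q.2 → p ≠ q → (a : ℤ) ≤ |p.1 - q.1|) ∧
  (∀ p ∈ P, 1 ≤ p.2 → ∃ q ∈ P, q.2 = p.2 - 1 ∧ |p.1 - q.1| ≤ (a : ℤ) - 1)

section Window

variable {M : Type*} [Monoid M]

/-- The ordered product `w L * w (L + 1) * ⋯ * w (L + n - 1)`. -/
def windowProd (w : ℤ → M) (L : ℤ) : ℕ → M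
  | 0 => 1
  | n + 1 => w L * windowProd w (L + 1) n

theorem windowProd_add (w : ℤ → M) (L : ℤ) (m n : ℕ) :
    windowProd w L (m + n) = windowProd w L m * windowProd w (L + m) n := by
  induction m generalizing L with
  | zero => simp [windowProd]
  | succ m ih =>
    rw [Nat.add_right_comm, windowProd, windowProd, ih, mul_assoc]
    congr 3
    push_cast
    ring

theorem windowProd_congr {w w' : ℤ → M} {L : ℤ} {n : ℕ}
    (h : ∀ i, L ≤ i → i < L + n → w i = w' i) : windowProd w L n = windowProd w' L n := by
  induction n generalizing L with
  | zero => rfl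
  | succ n ih =>
    rw [windowProd, windowProd, h L le_rfl (by omega), ih fun i hi hi' => h i (by omega) (by omega)]

theorem windowProd_eq_pow {w : ℤ → M} {c : M} {L : ℤ} {n : ℕ}
    (h : ∀ i, L ≤ i → i < L + n → w i = c) : windowProd w L n = c ^ n := by
  induction n generalizing L with
  | zero => exact (pow_zero c).symm
  | succ n ih =>
    rw [windowProd, h L le_rfl (by omega), ih fun i hi hi' => h i (by omega) (by omega), pow_succ']

theorem windowProd_split (w : ℤ → M) (L : ℤ) (i b j : ℕ) :
    windowProd w L (i + (b + ((b + j) + 1))) = windowProd w L i * (windowProd w (L + i) b *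
      (w (L + i + b) * (windowProd w (L + i + b + 1) b *
        windowProd w (L + i + b + 1 + b) j))) := by
  rw [windowProd_add, windowProd_add, windowProd, windowProd_add]

/-- As a function of the factor at one position, a window product is `B ↦ U * B * V`. -/
theorem exists_windowProd_eq_mul (w : ℤ → M) {L x : ℤ} {n : ℕ} (hL : L ≤ x) (hn : x < L + n) :
    ∃ U V : M, ∀ w' : ℤ → M, (∀ i, i ≠ x → w' i = w i) → windowProd w' L n = U * w' x * V := by
  obtain ⟨i, rfl⟩ : ∃ i : ℕ, x = L + i := ⟨(x - L).toNat, by omega⟩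
  obtain ⟨j, rfl⟩ : ∃ j, n = i + (j + 1) := ⟨n - i - 1, by omega⟩
  refine ⟨windowProd w L i, windowProd w (L + i + 1) j, fun w' h => ?_⟩
  rw [windowProd_add, windowProd, ← mul_assoc]
  congr 1
  · rw [windowProd_congr fun k hk hk' => h k (by omega)]
  · exact windowProd_congr fun k hk hk' => h k (by omega)

end Window

section HardRods

variable {R : Type*} [CommRing R] (b : ℕ) (x : R)

/-- Transfer operator of an empty site in the gas of rods of length `b + 1`.
The state `j` is the number of sites still covered by the last rod. -/
def vacancy : Module.End R (ℕ → R) where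
  toFun φ j := if j = 0 then (1 + x) * φ 0 else if j ≤ b then φ (j - 1) else 0
  map_add' φ ψ := by ext j; simp only [Pi.add_apply]; split_ifs <;> ring
  map_smul' c φ := by
    ext j; simp only [Pi.smul_apply, smul_eq_mul, RingHom.id_apply]; split_ifs <;> ring

/-- Transfer operator of a site where a rod of length `b + 1` starts. -/
def rod : Module.End R (ℕ → R) where
  toFun φ j := if j = 0 then x * φ b else 0
  map_add' φ ψ := by ext j; simp only [Pi.add_apply]; split_ifs <;> ring
  map_smul' c φ := by
    ext j; simp only [Pi.smul_apply, smul_eq_mul, RingHom.id_apply]; split_ifs <;> ring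

theorem vacancy_apply (φ : ℕ → R) (j : ℕ) : vacancy b x φ j =
    if j = 0 then (1 + x) * φ 0 else if j ≤ b then φ (j - 1) else 0 := rfl

theorem rod_apply (φ : ℕ → R) (j : ℕ) : rod b x φ j = if j = 0 then x * φ b else 0 := rfl

/-- The stationary functional of `vacancy - rod`, up to normalization. -/
def stationary : (ℕ → R) →ₗ[R] R :=
  LinearMap.proj 0 - x • ∑ j ∈ Finset.range b, LinearMap.proj (j + 1)

theorem stationary_apply (φ : ℕ → R) :
    stationary b x φ = φ 0 - x * ∑ j ∈ Finset.range b, φ (j + 1) := by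
  simp [stationary]

/-- The indicator function of the admissible states `0, …, b`. -/
def admissible (R : Type*) [CommRing R] (b : ℕ) : ℕ → R := fun j => if j ≤ b then 1 else 0

theorem stationary_vacancy_sub_rod (φ : ℕ → R) :
    stationary b x ((vacancy b x - rod b x) φ) = stationary b x φ := by
  have h1 : ∑ j ∈ Finset.range b, (vacancy b x φ (j + 1) - rod b x φ (j + 1)) =
      ∑ j ∈ Finset.range b, φ j := by
    refine Finset.sum_congr rfl fun j hj => ?_
    have := Finset.mem_range.1 hj
    simp [vacancy_apply, rod_apply, Nat.succ_le_of_lt this]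
  have h2 := Finset.sum_range_succ φ b
  rw [Finset.sum_range_succ'] at h2
  simp only [stationary_apply, LinearMap.sub_apply, Pi.sub_apply, h1]
  simp only [vacancy_apply, rod_apply, if_true]
  linear_combination x * h2

theorem vacancy_sub_rod_admissible :
    (vacancy b x - rod b x) (admissible R b) = admissible R b := by
  ext j
  rcases j with _ | j
  · simp [vacancy_apply, rod_apply, admissible]
  · by_cases h : j + 1 ≤ b
    · simp [vacancy_apply, rod_apply, admissible, h, Nat.le_of_succ_le h]
    · simp [vacancy_apply, rod_apply, admissible, h]

theorem vacancy_pow_apply (φ : ℕ → R) (k : ℕ) {j : ℕ} (hj : j ≤ b) :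
    (vacancy b x ^ k) φ j = if k ≤ j then φ (j - k) else (1 + x) ^ (k - j) * φ 0 := by
  induction k generalizing j with
  | zero => simp
  | succ k ih =>
    rw [pow_succ', Module.End.mul_apply, vacancy_apply]
    rcases j with _ | j
    · rw [if_pos rfl, ih (Nat.zero_le b)]
      rcases k with _ | k
      · simp
      · simp [pow_succ']; ring
    · rw [if_neg (Nat.succ_ne_zero j), if_pos hj, ih (by omega)]
      simp

/-- A rod with `b` empty sites on both sides may be traded for `b + 1` further empty sites. -/
theorem vacancy_pow_mul_rod {z : R} (hz : z * (1 + x) ^ (b + 1) = x) :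
    vacancy b x ^ b * (rod b x * vacancy b x ^ b) = z • vacancy b x ^ (b + (b + 1)) := by
  ext1 φ
  ext j
  rw [Module.End.mul_apply, LinearMap.smul_apply, Pi.smul_apply, smul_eq_mul]
  by_cases hj : j ≤ b
  · rw [vacancy_pow_apply _ _ _ _ hj, vacancy_pow_apply _ _ _ _ hj,
      if_neg (by omega : ¬ b + (b + 1) ≤ j)]
    simp only [Module.End.mul_apply, rod_apply, vacancy_pow_apply _ _ _ _ le_rfl, le_refl,
      Nat.sub_self, if_true]
    split_ifs with h1 h2
    · obtain rfl : j = b := by omega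
      rw [show j + (j + 1) - j = j + 1 by omega]
      linear_combination -(φ 0) * hz
    · omega
    · rw [show b + (b + 1) - j = (b - j) + (b + 1) by omega, pow_add]
      linear_combination -((1 + x) ^ (b - j) * φ 0) * hz
  · have h (k : ℕ) (ψ : ℕ → R) : (vacancy b x ^ (k + 1)) ψ j = 0 := by
      rw [pow_succ', Module.End.mul_apply, vacancy_apply, if_neg (by omega), if_neg hj]
    rw [← add_assoc, h, mul_zero]
    rcases b with _ | b
    · rw [pow_zero, Module.End.one_apply, Module.End.mul_apply, rod_apply, if_neg (by omega)]
    · exact h _ _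

/-- The operator at site `i` when rods start at the sites of `S`, the sites of `E` are empty and
all other sites are unconstrained. -/
noncomputable def siteOp (S E : Finset ℤ) (i : ℤ) : Module.End R (ℕ → R) :=
  if i ∈ S then rod b x else if i ∈ E then vacancy b x else vacancy b x - rod b x

theorem siteOp_supported (S E : Finset ℤ) (i : ℤ) {c : ℕ} {φ : ℕ → R} (h : ∀ j, c < j → φ j = 0)
    (j : ℕ) (hj : c + 1 < j) : siteOp b x S E i φ j = 0 := by
  have h0 : j ≠ 0 := by omega
  have h1 : φ (j - 1) = 0 := h _ (by omega)
  unfold siteOp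
  split_ifs <;> simp [rod_apply, vacancy_apply, h0, h1]

theorem windowProd_siteOp_supported (S E : Finset ℤ) (L : ℤ) (n : ℕ) {φ : ℕ → R}
    (h : ∀ j, 0 < j → φ j = 0) (j : ℕ) (hj : n < j) :
    windowProd (siteOp b x S E) L n φ j = 0 := by
  induction n generalizing L j with
  | zero => exact h j hj
  | succ n ih => exact siteOp_supported b x S E L (ih (L + 1)) j hj

theorem windowProd_siteOp_eq_zero {S E : Finset ℤ} {L s t : ℤ} {n : ℕ} (hs : s ∈ S) (ht : t ∈ S)
    (hst : s < t) (hts : t ≤ s + b) (hL : L ≤ s) (hn : t < L + n) :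
    windowProd (siteOp b x S E) L n = 0 := by
  obtain ⟨i, rfl⟩ : ∃ i : ℕ, s = L + i := ⟨(s - L).toNat, by omega⟩
  obtain ⟨k, rfl⟩ : ∃ k : ℕ, t = L + i + 1 + k := ⟨(t - (L + i + 1)).toNat, by omega⟩
  obtain ⟨j, rfl⟩ : ∃ j, n = i + ((k + (j + 1)) + 1) := ⟨n - i - k - 2, by omega⟩
  rw [windowProd_add, windowProd, windowProd_add, windowProd]
  have h1 : siteOp b x S E (L + i) = rod b x := by simp [siteOp, hs]
  have h2 : siteOp b x S E (L + i + 1 + k) = rod b x := by simp [siteOp, ht]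
  rw [h1, h2]
  convert mul_zero _
  ext1 φ
  ext j'
  rw [Module.End.mul_apply, rod_apply, Module.End.mul_apply,
    windowProd_siteOp_supported b x _ _ _ _ _ _ (by omega : k < b)]
  · simp
  · intro l hl
    rw [Module.End.mul_apply, rod_apply, if_neg (by omega)]

theorem windowProd_siteOp_insert {S E : Finset ℤ} {L s : ℤ} {n : ℕ} (hS : s ∉ S) (hE : s ∉ E)
    (hL : L ≤ s) (hn : s < L + n) :
    windowProd (siteOp b x S (insert s E)) L n =
      windowProd (siteOp b x S E) L n + windowProd (siteOp b x (insert s S) E) L n := by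
  obtain ⟨U, V, h⟩ := exists_windowProd_eq_mul (siteOp b x S E) hL hn
  rw [h _ fun i hi => by simp [siteOp, hi], h _ fun i hi => rfl,
    h (siteOp b x (insert s S) E) fun i hi => by simp [siteOp, hi], ← add_mul, ← mul_add]
  simp [siteOp, hS, hE]

theorem windowProd_siteOp_eq_sum {S E : Finset ℤ} {L : ℤ} {n : ℕ} (hSE : Disjoint S E)
    (hE : ∀ s ∈ E, L ≤ s ∧ s < L + n) :
    windowProd (siteOp b x S E) L n =
      ∑ T ∈ E.powerset, windowProd (siteOp b x (S ∪ T) ∅) L n := by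
  induction E using Finset.induction_on generalizing S with
  | empty => simp
  | insert s E hs ih =>
    rw [Finset.disjoint_insert_right] at hSE
    have hE' : ∀ s ∈ E, L ≤ s ∧ s < L + n := fun t ht => hE t (Finset.mem_insert_of_mem ht)
    obtain ⟨h1, h2⟩ := hE s (Finset.mem_insert_self s E)
    rw [windowProd_siteOp_insert b x hSE.1 hs h1 h2, ih hSE.2 hE',
      ih (Finset.disjoint_insert_left.2 ⟨hs, hSE.2⟩) hE', Finset.sum_powerset_insert hs]
    simp [Finset.insert_union, Finset.union_insert]

/-- Sites at distance at most `b` from a rod are automatically empty. -/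
theorem windowProd_siteOp_near {S E : Finset ℤ} {L : ℤ} {n : ℕ} (hSE : Disjoint S E)
    (hS : ∀ s ∈ S, L ≤ s ∧ s < L + n) (hE : ∀ t ∈ E, L ≤ t ∧ t < L + n)
    (hnear : ∀ t ∈ E, ∃ s ∈ S, |t - s| ≤ b) :
    windowProd (siteOp b x S E) L n = windowProd (siteOp b x S ∅) L n := by
  induction E using Finset.induction_on with
  | empty => rfl
  | insert t E ht ih =>
    rw [Finset.disjoint_insert_right] at hSE
    obtain ⟨h1, h2⟩ := hE t (Finset.mem_insert_self t E)
    obtain ⟨s, hs, hts⟩ := hnear t (Finset.mem_insert_self t E)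
    have hne : s ≠ t := fun h => hSE.1 (h ▸ hs)
    obtain ⟨h3, h4⟩ := hS s hs
    rw [abs_le] at hts
    rw [windowProd_siteOp_insert b x hSE.1 ht h1 h2,
      ih hSE.2 (fun u hu => hE u (Finset.mem_insert_of_mem hu))
        fun u hu => hnear u (Finset.mem_insert_of_mem hu)]
    refine add_eq_left.2 ?_
    rcases lt_or_gt_of_ne hne with h | h
    · exact windowProd_siteOp_eq_zero b x (Finset.mem_insert_of_mem hs)
        (Finset.mem_insert_self t S) h (by omega) h3 h2
    · exact windowProd_siteOp_eq_zero b x (Finset.mem_insert_self t S)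
        (Finset.mem_insert_of_mem hs) h (by omega) h1 h4

theorem windowProd_siteOp_insert_rod {z : R} (hz : z * (1 + x) ^ (b + 1) = x) {S E : Finset ℤ}
    {L s : ℤ} {n : ℕ} (hs : s ∉ S) (hS : ∀ t ∈ S, (b : ℤ) < |t - s|)
    (hE : ∀ t, t ≠ s → |t - s| ≤ b → t ∈ E) (hL : L + b ≤ s) (hn : s + b < L + n) :
    windowProd (siteOp b x (insert s S) E) L n =
      z • windowProd (siteOp b x S (insert s E)) L n := by
  obtain ⟨i, rfl⟩ : ∃ i : ℕ, s = L + i + b := ⟨(s - L - b).toNat, by omega⟩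
  obtain ⟨j, rfl⟩ : ∃ j, n = i + (b + ((b + j) + 1)) := ⟨n - i - b - b - 1, by omega⟩
  have hfar (t : ℤ) (h : |t - (L + i + b)| ≤ b) : t ∉ S := fun ht => (hS t ht).not_ge h
  have hvac (t : ℤ) (h : t ≠ L + i + b) (h' : |t - (L + i + b)| ≤ b) :
      siteOp b x (insert (L + i + b) S) E t = vacancy b x := by
    simp [siteOp, h, hfar t h', hE t h h']
  have hvac' (t : ℤ) (h' : |t - (L + i + b)| ≤ b) :
      siteOp b x S (insert (L + i + b) E) t = vacancy b x := by
    by_cases h : t = L + i + b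
    · simp [siteOp, h, hs]
    · simp [siteOp, hfar t h', hE t h h']
  have heq (t : ℤ) (h : t ≠ L + i + b) :
      siteOp b x (insert (L + i + b) S) E t = siteOp b x S (insert (L + i + b) E) t := by
    simp [siteOp, h]
  have hmid : siteOp b x (insert (L + i + b) S) E (L + i + b) = rod b x := by simp [siteOp]
  rw [windowProd_split, windowProd_split, windowProd_congr fun t h1 h2 => heq t (by omega),
    windowProd_eq_pow fun t h1 h2 => hvac t (by omega) (abs_le.2 (by omega)), hmid,
    windowProd_eq_pow fun t h1 h2 => hvac t (by omega) (abs_le.2 (by omega)),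
    windowProd_congr (L := L + i + b + 1 + b) fun t h1 h2 => heq t (by omega),
    windowProd_eq_pow (L := L + i) fun t h1 h2 => hvac' t (abs_le.2 (by omega)),
    hvac' _ (by simp),
    windowProd_eq_pow (L := L + i + b + 1) fun t h1 h2 => hvac' t (abs_le.2 (by omega))]
  have := vacancy_pow_mul_rod b x hz
  rw [pow_add, pow_succ'] at this
  rw [← mul_assoc (rod b x), ← mul_assoc (vacancy b x ^ b), this, smul_mul_assoc, mul_smul_comm]
  simp only [mul_assoc]

theorem windowProd_siteOp_union {z : R} (hz : z * (1 + x) ^ (b + 1) = x) {S E : Finset ℤ}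
    {L : ℤ} {n : ℕ} (hSE : Disjoint S E) (hE : ∀ s ∈ S, ∀ t, t ≠ s → |t - s| ≤ b → t ∈ E)
    (hS : ∀ s ∈ S, L + b ≤ s ∧ s + b < L + n) :
    windowProd (siteOp b x S E) L n = z ^ S.card • windowProd (siteOp b x ∅ (S ∪ E)) L n := by
  induction S using Finset.induction_on generalizing E with
  | empty => simp
  | insert s S hs ih =>
    rw [Finset.disjoint_insert_left] at hSE
    obtain ⟨h1, h2⟩ := hS s (Finset.mem_insert_self s S)
    rw [windowProd_siteOp_insert_rod b x hz hs _ (hE s (Finset.mem_insert_self s S)) h1 h2, ih,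
      Finset.card_insert_of_notMem hs, pow_succ', smul_smul, Finset.union_insert,
      Finset.insert_union]
    · exact Finset.disjoint_insert_right.2 ⟨hs, hSE.2⟩
    · exact fun t ht u hu hut =>
        Finset.mem_insert_of_mem (hE t (Finset.mem_insert_of_mem ht) u hu hut)
    · exact fun t ht => hS t (Finset.mem_insert_of_mem ht)
    · intro t ht
      by_contra! h
      exact Finset.disjoint_left.1 hSE.2 ht
        (hE s (Finset.mem_insert_self s S) t (fun h' => hs (h' ▸ ht)) h)

/-- The sites at distance at most `b` from `S`. -/
noncomputable def neighborhood (S : Finset ℤ) : Finset ℤ :=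
  S.biUnion fun s => Finset.Icc (s - b) (s + b)

theorem mem_neighborhood {S : Finset ℤ} {t : ℤ} :
    t ∈ neighborhood b S ↔ ∃ s ∈ S, |t - s| ≤ b := by
  simp only [neighborhood, Finset.mem_biUnion, Finset.mem_Icc, abs_le]
  exact exists_congr fun s => and_congr_right fun _ => by omega

theorem windowProd_siteOp_eq_smul_sum {z : R} (hz : z * (1 + x) ^ (b + 1) = x) {S : Finset ℤ}
    {L : ℤ} {n : ℕ} (hsep : ∀ s ∈ S, ∀ t ∈ S, t ≠ s → (b : ℤ) < |t - s|)
    (hS : ∀ s ∈ S, L + b ≤ s ∧ s + b < L + n) :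
    windowProd (siteOp b x S ∅) L n = z ^ S.card •
      ∑ T ∈ (neighborhood b S).powerset, windowProd (siteOp b x T ∅) L n := by
  have hwin : ∀ t ∈ neighborhood b S, L ≤ t ∧ t < L + n := by
    intro t ht
    obtain ⟨s, hs, hst⟩ := (mem_neighborhood b).1 ht
    obtain ⟨h1, h2⟩ := hS s hs
    rw [abs_le] at hst
    omega
  have hsub : S ⊆ neighborhood b S := fun s hs => (mem_neighborhood b).2 ⟨s, hs, by simp⟩
  rw [← windowProd_siteOp_near b x (E := neighborhood b S \ S) Finset.disjoint_sdiff
    (fun s hs => hwin s (hsub hs)) (fun t ht => hwin t (Finset.mem_sdiff.1 ht).1)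
    (fun t ht => (mem_neighborhood b).1 (Finset.mem_sdiff.1 ht).1),
    windowProd_siteOp_union b x hz Finset.disjoint_sdiff _ hS, Finset.union_sdiff_of_subset hsub,
    windowProd_siteOp_eq_sum b x (Finset.disjoint_empty_left _) hwin]
  · simp
  · exact fun s hs t hts hst => Finset.mem_sdiff.2
      ⟨(mem_neighborhood b).2 ⟨s, hs, hst⟩, fun ht => (hsep s hs t ht hts).not_ge hst⟩

/-- The signed correlation function of the rod gas: the weight of rods starting at the sites
of `S`, computed in the window `[L, L + n)`. -/
noncomputable def correlation (L : ℤ) (n : ℕ) (S : Finset ℤ) : R :=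
  stationary b x (windowProd (siteOp b x S ∅) L n (admissible R b))

theorem correlation_eq_sum {z : R} (hz : z * (1 + x) ^ (b + 1) = x) {S : Finset ℤ}
    {L : ℤ} {n : ℕ} (hsep : ∀ s ∈ S, ∀ t ∈ S, t ≠ s → (b : ℤ) < |t - s|)
    (hS : ∀ s ∈ S, L + b ≤ s ∧ s + b < L + n) :
    correlation b x L n S =
      z ^ S.card * ∑ T ∈ (neighborhood b S).powerset, correlation b x L n T := by
  rw [correlation, windowProd_siteOp_eq_smul_sum b x hz hsep hS]
  simp [correlation, LinearMap.sum_apply, Finset.mul_sum, Finset.smul_sum]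

theorem correlation_eq_zero {S : Finset ℤ} {L : ℤ} {n : ℕ}
    (hsep : ¬ ∀ s ∈ S, ∀ t ∈ S, t ≠ s → (b : ℤ) < |t - s|)
    (hS : ∀ s ∈ S, L ≤ s ∧ s < L + n) : correlation b x L n S = 0 := by
  push Not at hsep
  obtain ⟨s, hs, t, ht, hne, hst⟩ := hsep
  rw [abs_le] at hst
  have : windowProd (siteOp b x S ∅) L n = 0 := by
    rcases lt_or_gt_of_ne hne with h | h
    · exact windowProd_siteOp_eq_zero b x ht hs h (by omega) (hS t ht).1 (hS s hs).2
    · exact windowProd_siteOp_eq_zero b x hs ht h (by omega) (hS s hs).1 (hS t ht).2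
  simp [correlation, this]

theorem vacancy_sub_rod_pow_admissible (n : ℕ) :
    ((vacancy b x - rod b x) ^ n) (admissible R b) = admissible R b := by
  induction n with
  | zero => rfl
  | succ n ih => rw [pow_succ', Module.End.mul_apply, ih, vacancy_sub_rod_admissible]

theorem stationary_vacancy_sub_rod_pow (n : ℕ) (φ : ℕ → R) :
    stationary b x (((vacancy b x - rod b x) ^ n) φ) = stationary b x φ := by
  induction n with
  | zero => rfl
  | succ n ih => rw [pow_succ', Module.End.mul_apply, stationary_vacancy_sub_rod, ih]

theorem correlation_empty (L : ℤ) (n : ℕ) : correlation b x L n ∅ = 1 - b * x := by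
  rw [correlation, windowProd_eq_pow (c := vacancy b x - rod b x) fun i _ _ => by simp [siteOp],
    vacancy_sub_rod_pow_admissible, stationary_apply, Finset.sum_congr rfl fun j hj =>
      show admissible R b (j + 1) = 1 from if_pos (Finset.mem_range.1 hj)]
  simp [admissible, mul_comm]

theorem correlation_singleton {L s : ℤ} {n : ℕ} (hL : L ≤ s) (hn : s < L + n) :
    correlation b x L n {s} = x := by
  obtain ⟨i, rfl⟩ : ∃ i : ℕ, s = L + i := ⟨(s - L).toNat, by omega⟩
  obtain ⟨j, rfl⟩ : ∃ j, n = i + (j + 1) := ⟨n - i - 1, by omega⟩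
  have h (t : ℤ) (ht : t ≠ L + i) : siteOp b x {L + i} ∅ t = vacancy b x - rod b x := by
    simp [siteOp, ht]
  rw [correlation, windowProd_add, windowProd, windowProd_eq_pow fun t _ _ => h t (by omega),
    windowProd_eq_pow fun t _ _ => h t (by omega), Module.End.mul_apply, Module.End.mul_apply,
    vacancy_sub_rod_pow_admissible, stationary_vacancy_sub_rod_pow]
  simp [siteOp, stationary_apply, rod_apply, admissible]

end HardRods

section Heaps

variable (b : ℕ)

/-- Heaps of pieces of length `b + 1` whose bottom level is `S`. -/
def IsHeap (S : Finset ℤ) (P : Finset (ℤ × ℕ)) : Prop :=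
  (∀ s, (s, 0) ∈ P ↔ s ∈ S) ∧
  (∀ h s t, (s, h) ∈ P → (t, h) ∈ P → t ≠ s → (b : ℤ) < |t - s|) ∧
  ∀ h s, (s, h + 1) ∈ P → ∃ t, (t, h) ∈ P ∧ |s - t| ≤ b

/-- Raise `P` by one level and insert `S` as the new bottom level. -/
def stack (S : Finset ℤ) (P : Finset (ℤ × ℕ)) : Finset (ℤ × ℕ) :=
  S ×ˢ {0} ∪ P.map ⟨Prod.map id Nat.succ, Function.injective_id.prodMap Nat.succ_injective⟩

theorem mem_stack_zero {S : Finset ℤ} {P : Finset (ℤ × ℕ)} {s : ℤ} :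
    (s, 0) ∈ stack S P ↔ s ∈ S := by
  simp [stack]

theorem mem_stack_succ {S : Finset ℤ} {P : Finset (ℤ × ℕ)} {s : ℤ} {h : ℕ} :
    (s, h + 1) ∈ stack S P ↔ (s, h) ∈ P := by
  simp [stack]

theorem card_stack (S : Finset ℤ) (P : Finset (ℤ × ℕ)) :
    (stack S P).card = S.card + P.card := by
  rw [stack, Finset.card_union_of_disjoint, Finset.card_product, Finset.card_map]
  · simp
  · rw [Finset.disjoint_left]
    rintro ⟨s, h⟩ h1 h2
    simp only [Finset.mem_product, Finset.mem_singleton] at h1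
    simp [h1.2] at h2

/-- The pieces of `P` above the bottom level, lowered by one level. -/
def upperPart (P : Finset (ℤ × ℕ)) : Finset (ℤ × ℕ) :=
  (P.filter fun p => p.2 ≠ 0).image fun p => (p.1, p.2 - 1)

theorem mem_upperPart {P : Finset (ℤ × ℕ)} {s : ℤ} {h : ℕ} :
    (s, h) ∈ upperPart P ↔ (s, h + 1) ∈ P := by
  simp only [upperPart, Finset.mem_image, Finset.mem_filter, Prod.exists, Prod.mk.injEq]
  constructor
  · rintro ⟨t, k, ⟨hP, hk⟩, rfl, rfl⟩
    rwa [Nat.sub_one_add_one hk]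
  · exact fun hP => ⟨s, h + 1, ⟨hP, Nat.succ_ne_zero h⟩, rfl, rfl⟩

/-- The bottom level of `P`. -/
def bottom (P : Finset (ℤ × ℕ)) : Finset ℤ := (P.filter fun p => p.2 = 0).image Prod.fst

theorem mem_bottom {P : Finset (ℤ × ℕ)} {s : ℤ} : s ∈ bottom P ↔ (s, 0) ∈ P := by
  simp [bottom]

theorem upperPart_stack (S : Finset ℤ) (P : Finset (ℤ × ℕ)) : upperPart (stack S P) = P := by
  ext ⟨s, h⟩
  rw [mem_upperPart, mem_stack_succ]

theorem IsHeap.bottom_eq {b : ℕ} {S : Finset ℤ} {P : Finset (ℤ × ℕ)} (hP : IsHeap b S P) :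
    bottom P = S := by
  ext s
  rw [mem_bottom, hP.1]

theorem IsHeap.stack_upperPart {b : ℕ} {S : Finset ℤ} {P : Finset (ℤ × ℕ)} (hP : IsHeap b S P) :
    stack S (upperPart P) = P := by
  ext ⟨s, h⟩
  rcases h with _ | h
  · rw [mem_stack_zero, hP.1]
  · rw [mem_stack_succ, mem_upperPart]

theorem IsHeap.separated {b : ℕ} {S : Finset ℤ} {P : Finset (ℤ × ℕ)} (hP : IsHeap b S P) :
    ∀ s ∈ S, ∀ t ∈ S, t ≠ s → (b : ℤ) < |t - s| :=
  fun s hs t ht => hP.2.1 0 s t ((hP.1 s).2 hs) ((hP.1 t).2 ht)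

theorem IsHeap.upperPart {b : ℕ} {S : Finset ℤ} {P : Finset (ℤ × ℕ)} (hP : IsHeap b S P) :
    IsHeap b (bottom (upperPart P)) (upperPart P) := by
  refine ⟨fun s => mem_bottom.symm, fun h s t hs ht => ?_, fun h s hs => ?_⟩
  · exact hP.2.1 (h + 1) s t (mem_upperPart.1 hs) (mem_upperPart.1 ht)
  · obtain ⟨t, ht, hst⟩ := hP.2.2 (h + 1) s (mem_upperPart.1 hs)
    exact ⟨t, mem_upperPart.2 ht, hst⟩

theorem IsHeap.bottom_upperPart_subset {b : ℕ} {S : Finset ℤ} {P : Finset (ℤ × ℕ)}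
    (hP : IsHeap b S P) : bottom (_root_.upperPart P) ⊆ neighborhood b S := by
  intro s hs
  obtain ⟨t, ht, hst⟩ := hP.2.2 0 s (mem_upperPart.1 (mem_bottom.1 hs))
  exact (mem_neighborhood b).2 ⟨t, (hP.1 t).1 ht, hst⟩

theorem IsHeap.stack {b : ℕ} {S T : Finset ℤ} {P : Finset (ℤ × ℕ)} (hP : IsHeap b T P)
    (hS : ∀ s ∈ S, ∀ t ∈ S, t ≠ s → (b : ℤ) < |t - s|) (hT : T ⊆ neighborhood b S) :
    IsHeap b S (stack S P) := by
  refine ⟨fun s => mem_stack_zero, fun h s t hs ht => ?_, fun h s hs => ?_⟩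
  · rcases h with _ | h
    · exact hS s (mem_stack_zero.1 hs) t (mem_stack_zero.1 ht)
    · exact hP.2.1 h s t (mem_stack_succ.1 hs) (mem_stack_succ.1 ht)
  · rw [mem_stack_succ] at hs
    rcases h with _ | h
    · obtain ⟨t, ht, hst⟩ := (mem_neighborhood b).1 (hT ((hP.1 s).1 hs))
      exact ⟨t, mem_stack_zero.2 ht, hst⟩
    · obtain ⟨t, ht, hst⟩ := hP.2.2 h s hs
      exact ⟨t, mem_stack_succ.2 ht, hst⟩

theorem IsHeap.eq_empty {b : ℕ} {P : Finset (ℤ × ℕ)} (hP : IsHeap b ∅ P) : P = ∅ := by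
  have h (k : ℕ) : ∀ s, (s, k) ∉ P := by
    induction k with
    | zero => simp [hP.1]
    | succ k ih =>
      intro s hs
      obtain ⟨t, ht, -⟩ := hP.2.2 k s hs
      exact ih t ht
  exact Finset.eq_empty_of_forall_notMem fun p => h p.2 p.1

theorem isHeap_empty (b : ℕ) : IsHeap b ∅ ∅ := by simp [IsHeap]

theorem IsHeap.card_le {b : ℕ} {S : Finset ℤ} {P : Finset (ℤ × ℕ)} (hP : IsHeap b S P) :
    S.card ≤ P.card := by
  rw [← hP.stack_upperPart, card_stack]
  exact Nat.le_add_right _ _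

/-- Removing the bottom level of a heap. -/
def heapEquiv {S : Finset ℤ} (hS : ∀ s ∈ S, ∀ t ∈ S, t ≠ s → (b : ℤ) < |t - s|) (k : ℕ) :
    {P // IsHeap b S P ∧ P.card = S.card + k} ≃
      Σ T : (neighborhood b S).powerset, {P // IsHeap b T P ∧ P.card = k} where
  toFun P := ⟨⟨bottom (upperPart P), Finset.mem_powerset.2 P.2.1.bottom_upperPart_subset⟩,
    upperPart P, P.2.1.upperPart, by
      have h := P.2.2
      rw [← P.2.1.stack_upperPart, card_stack] at h
      omega⟩
  invFun Q := ⟨stack S Q.2, Q.2.2.1.stack hS (Finset.mem_powerset.1 Q.1.2), by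
    rw [card_stack, Q.2.2.2]⟩
  left_inv P := Subtype.ext P.2.1.stack_upperPart
  right_inv := by
    rintro ⟨⟨T, hT⟩, P, hP, hk⟩
    have h : bottom (upperPart (stack S P)) = T := by rw [upperPart_stack, hP.bottom_eq]
    exact Sigma.subtype_ext (Subtype.ext h) (upperPart_stack S P)

/-- The number of heaps of size `k` with bottom level `S`. -/
noncomputable def heapCount (S : Finset ℤ) (k : ℕ) : ℕ :=
  Nat.card {P // IsHeap b S P ∧ P.card = k}

theorem heapCount_empty (k : ℕ) : heapCount b ∅ k = if k = 0 then 1 else 0 := by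
  rw [heapCount]
  split_ifs with hk
  · rw [Nat.card_eq_one_iff_unique]
    exact ⟨⟨fun P Q => Subtype.ext (P.2.1.eq_empty.trans Q.2.1.eq_empty.symm)⟩,
      ⟨∅, isHeap_empty b, by simp [hk]⟩⟩
  · have : IsEmpty {P // IsHeap b ∅ P ∧ P.card = k} :=
      ⟨fun P => hk (by rw [← P.2.2, P.2.1.eq_empty, Finset.card_empty])⟩
    exact Nat.card_of_isEmpty

theorem heapCount_eq_zero_of_lt {S : Finset ℤ} {k : ℕ} (h : k < S.card) : heapCount b S k = 0 := by
  have : IsEmpty {P // IsHeap b S P ∧ P.card = k} :=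
    ⟨fun P => (P.2.1.card_le.trans_eq P.2.2).not_gt h⟩
  exact Nat.card_of_isEmpty

theorem isEmpty_heap {S : Finset ℤ} (h : ¬ ∀ s ∈ S, ∀ t ∈ S, t ≠ s → (b : ℤ) < |t - s|) (k : ℕ) :
    IsEmpty {P // IsHeap b S P ∧ P.card = k} :=
  ⟨fun P => h P.2.1.separated⟩

theorem finite_heap (S : Finset ℤ) (k : ℕ) : Finite {P // IsHeap b S P ∧ P.card = k} := by
  induction k using Nat.strong_induction_on generalizing S with
  | _ k ih =>
    rcases S.eq_empty_or_nonempty with rfl | hne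
    · have : Subsingleton {P // IsHeap b ∅ P ∧ P.card = k} :=
        ⟨fun P Q => Subtype.ext (P.2.1.eq_empty.trans Q.2.1.eq_empty.symm)⟩
      infer_instance
    by_cases hS : ∀ s ∈ S, ∀ t ∈ S, t ≠ s → (b : ℤ) < |t - s|
    · rcases lt_or_ge k S.card with h | h
      · have : IsEmpty {P // IsHeap b S P ∧ P.card = k} :=
          ⟨fun P => (P.2.1.card_le.trans_eq P.2.2).not_gt h⟩
        infer_instance
      · obtain ⟨j, rfl⟩ := Nat.exists_eq_add_of_le h
        have (T : (neighborhood b S).powerset) : Finite {P // IsHeap b T P ∧ P.card = j} :=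
          ih j (by have := hne.card_pos; omega) T
        exact Finite.of_equiv _ (heapEquiv b hS j).symm
    · have := isEmpty_heap b hS k
      infer_instance

theorem heapCount_card_add {S : Finset ℤ}
    (hS : ∀ s ∈ S, ∀ t ∈ S, t ≠ s → (b : ℤ) < |t - s|) (k : ℕ) :
    heapCount b S (S.card + k) = ∑ T ∈ (neighborhood b S).powerset, heapCount b T k := by
  have (T : (neighborhood b S).powerset) := finite_heap b T k
  rw [heapCount, Nat.card_congr (heapEquiv b hS k), Nat.card_sigma,
    ← Finset.sum_coe_sort (neighborhood b S).powerset]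
  rfl

open PowerSeries in
/-- Up to normalization, the generating function of the heaps with bottom level `S` is the
correlation function of `S`. -/
theorem X_pow_dvd_correlation_sub {x z : ℤ⟦X⟧} (hz : z * (1 + x) ^ (b + 1) = x) (hXz : X ∣ z)
    (N : ℕ) {S : Finset ℤ} {L : ℤ} {n : ℕ}
    (hS : ∀ s ∈ S, L + N * b ≤ s ∧ s + N * b < L + n) :
    X ^ N ∣ correlation b x L n S -
      (1 - (b : ℤ⟦X⟧) * x) * ∑ k ∈ Finset.range N, (heapCount b S k : ℤ⟦X⟧) * z ^ k := by
  induction N generalizing S with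
  | zero => simp
  | succ N ih =>
    have hNb : 0 ≤ (N * b : ℤ) := by positivity
    have hNb' : ((N + 1 : ℕ) * b : ℤ) = N * b + b := by push_cast; ring
    rw [hNb'] at hS
    have hS' : ∀ s ∈ S, L + b ≤ s ∧ s + b < L + n := fun s hs => by have := hS s hs; omega
    rcases S.eq_empty_or_nonempty with rfl | hne
    · simp [correlation_empty, heapCount_empty]
    by_cases hsep : ∀ s ∈ S, ∀ t ∈ S, t ≠ s → (b : ℤ) < |t - s|
    · obtain ⟨c, hc⟩ : ∃ c, S.card = c + 1 := Nat.exists_eq_add_one.2 hne.card_pos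
      have hsum := Finset.sum_range_add (fun k => (heapCount b S k : ℤ⟦X⟧) * z ^ k) (N + 1) c
      rw [show N + 1 + c = S.card + N by omega, Finset.sum_range_add] at hsum
      rw [Finset.sum_eq_zero fun k hk => by
        rw [heapCount_eq_zero_of_lt b (Finset.mem_range.1 hk), Nat.cast_zero, zero_mul],
        zero_add] at hsum
      have htail : X ^ (N + 1) ∣ ∑ k ∈ Finset.range c,
          (heapCount b S (N + 1 + k) : ℤ⟦X⟧) * z ^ (N + 1 + k) :=
        Finset.dvd_sum fun k _ => ((pow_dvd_pow_of_dvd hXz _).trans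
          (pow_dvd_pow z (Nat.le_add_right _ _))).mul_left _
      have hmain : X ^ (N + 1) ∣ z ^ S.card * ∑ T ∈ (neighborhood b S).powerset,
          (correlation b x L n T -
            (1 - (b : ℤ⟦X⟧) * x) * ∑ k ∈ Finset.range N, (heapCount b T k : ℤ⟦X⟧) * z ^ k) := by
        rw [pow_succ']
        refine mul_dvd_mul (hXz.trans (dvd_pow_self z hne.card_pos.ne'))
          (Finset.dvd_sum fun T hT => ih fun t ht => ?_)
        obtain ⟨s, hs, hst⟩ := (mem_neighborhood b).1 (Finset.mem_powerset.1 hT ht)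
        have := hS s hs
        rw [abs_le] at hst
        omega
      convert hmain.add (htail.mul_left (1 - (b : ℤ⟦X⟧) * x)) using 1
      rw [correlation_eq_sum b x hz hsep hS',
        Finset.sum_sub_distrib, ← Finset.mul_sum, Finset.sum_comm]
      have : ∑ k ∈ Finset.range N, (heapCount b S (S.card + k) : ℤ⟦X⟧) * z ^ (S.card + k) =
          z ^ S.card * ∑ k ∈ Finset.range N, ∑ T ∈ (neighborhood b S).powerset,
            (heapCount b T k : ℤ⟦X⟧) * z ^ k := by
        rw [Finset.mul_sum]
        refine Finset.sum_congr rfl fun k _ => ?_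
        rw [heapCount_card_add b hsep, ← Finset.sum_mul, Nat.cast_sum, pow_add]
        ring
      linear_combination (1 - (b : ℤ⟦X⟧) * x) * (hsum - this)
    · rw [correlation_eq_zero b x hsep fun s hs => by have := hS' s hs; omega]
      have h (k : ℕ) : heapCount b S k = 0 := by
        have := isEmpty_heap b hsep k
        exact Nat.card_of_isEmpty
      simp [h]

end Heaps

section Coefficients

open Finset

open Polynomial in
theorem sum_neg_one_pow_mul_choose_mul_choose (b n : ℕ) :
    ∑ j ∈ range (n + 1), (-1 : ℤ) ^ (n - j) * n.choose j * (b * (j + 1) + n).choose n =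
      (b : ℤ) ^ n := by
  obtain ⟨q, hq⟩ := sub_dvd_pow_sub_pow (1 + X : ℤ[X]) 1 b
  rw [one_pow, add_sub_cancel_left] at hq
  have hq0 : q.coeff 0 = b := by
    have := congrArg (fun p : ℤ[X] => p.coeff 1) hq
    simpa [coeff_one_add_X_pow, coeff_one] using this.symm
  have hpow : ∑ j ∈ range (n + 1),
      C ((-1 : ℤ) ^ (n - j) * n.choose j) * (1 + X : ℤ[X]) ^ (b * (j + 1) + n) =
      X ^ n * ((1 + X) ^ (b + n) * q ^ n) := by
    calc _ = (1 + X : ℤ[X]) ^ (b + n) * ((1 + X) ^ b - 1) ^ n := by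
          rw [sub_eq_add_neg, add_pow ((1 + X : ℤ[X]) ^ b), mul_sum]
          refine sum_congr rfl fun j _ => ?_
          simp only [C_mul, C_pow, C_neg, C_1, map_natCast, ← pow_mul]
          ring
      _ = _ := by rw [hq]; ring
  have := congrArg (fun p : ℤ[X] => p.coeff n) hpow
  simp only [finsetSum_coeff, coeff_C_mul, coeff_one_add_X_pow, coeff_X_pow_mul', le_refl,
    if_true, Nat.sub_self, mul_coeff_zero] at this
  rw [this, ← hq0]
  simp [coeff_zero_eq_eval_zero]

open PowerSeries

theorem invOneSubPow_pow (a k : ℕ) : invOneSubPow ℤ a ^ k = invOneSubPow ℤ (a * k) := by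
  induction k with
  | zero => simp [invOneSubPow_zero]
  | succ k ih => rw [pow_succ, ih, Nat.mul_succ, invOneSubPow_add]

/-- The power series `-X / (1 - X) ^ (b + 1)`. -/
noncomputable def fugacity (b : ℕ) : ℤ⟦X⟧ := -(X * (invOneSubPow ℤ (b + 1)).val)

theorem fugacity_mul_pow (b : ℕ) : fugacity b * (1 + -X) ^ (b + 1) = -X := by
  have h : (invOneSubPow ℤ (b + 1)).val * (1 - X) ^ (b + 1) = 1 := by
    rw [← invOneSubPow_inv_eq_one_sub_pow]
    exact (invOneSubPow ℤ (b + 1)).val_inv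
  rw [fugacity, ← sub_eq_add_neg]
  linear_combination (-X) * h

theorem coeff_fugacity_pow (b j n : ℕ) : coeff (n + 1) (fugacity b ^ (j + 1)) =
    if j ≤ n then (-1 : ℤ) ^ (j + 1) * (b * (j + 1) + n).choose (n - j) else 0 := by
  have h : fugacity b ^ (j + 1) = C ((-1 : ℤ) ^ (j + 1)) *
      (X ^ (j + 1) * PowerSeries.mk fun r => ((b * (j + 1) + j + r).choose (b * (j + 1) + j) : ℤ)) := by
    rw [fugacity, neg_pow, mul_pow, ← Units.val_pow_eq_pow_val, invOneSubPow_pow,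
      show (b + 1) * (j + 1) = b * (j + 1) + j + 1 by ring, invOneSubPow_val_succ_eq_mk_add_choose]
    simp
  rw [h, coeff_C_mul, coeff_X_pow_mul']
  by_cases hj : j ≤ n
  · obtain ⟨r, rfl⟩ := Nat.exists_eq_add_of_le hj
    rw [if_pos (by omega), if_pos hj, coeff_mk, show j + r + 1 - (j + 1) = r by omega,
      Nat.add_sub_cancel_left, Nat.choose_symm_add, add_assoc]
  · rw [if_neg (by omega), if_neg hj, mul_zero]

theorem coeff_sum_choose_mul_fugacity_pow (b : ℕ) {n N : ℕ} (hn : n < N) :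
    coeff (n + 1) (∑ j ∈ range N,
      (((b * (j + 1) + j).choose j : ℕ) : ℤ⟦X⟧) * fugacity b ^ (j + 1)) = -(-(b : ℤ)) ^ n := by
  simp only [map_sum, ← map_natCast (C : ℤ →+* ℤ⟦X⟧), coeff_C_mul, coeff_fugacity_pow]
  rw [← sum_subset (range_subset_range.2 hn) fun j _ hj => by
    rw [if_neg (by simpa [Nat.lt_succ_iff] using hj), mul_zero], neg_pow,
    ← sum_neg_one_pow_mul_choose_mul_choose, ← neg_mul, mul_sum]
  refine sum_congr rfl fun j hj => ?_
  obtain ⟨r, rfl⟩ := Nat.exists_eq_add_of_le (Nat.lt_succ_iff.1 (mem_range.1 hj))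
  have h := Nat.choose_mul (n := b * (j + 1) + (j + r)) (k := j + r) (s := r) (by omega)
  rw [show b * (j + 1) + (j + r) - r = b * (j + 1) + j by omega, Nat.add_sub_cancel,
    ← Nat.choose_symm_add (a := j)] at h
  replace h := congrArg (Nat.cast : ℕ → ℤ) h
  rw [if_pos (Nat.le_add_right j r), Nat.add_sub_cancel_left]
  push_cast at h
  have hr : (-1 : ℤ) ^ r * (-1) ^ r = 1 := by rw [← mul_pow]; simp
  rw [pow_add (-1) j r, pow_succ]
  linear_combination (-1) ^ j * h +
    (-1) ^ j * (j + r).choose j * (b * (j + 1) + (j + r)).choose (j + r) * hr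

theorem X_pow_dvd_sum_choose (b N : ℕ) :
    (X : ℤ⟦X⟧) ^ (N + 1) ∣ -X - (1 + (b : ℤ⟦X⟧) * X) * ∑ j ∈ range N,
      (((b * (j + 1) + j).choose j : ℕ) : ℤ⟦X⟧) * fugacity b ^ (j + 1) := by
  have hG : (1 + (b : ℤ⟦X⟧) * X) * (PowerSeries.mk fun n => (-(b : ℤ)) ^ n) = 1 := by
    ext n
    rw [add_mul, one_mul, mul_assoc, ← map_natCast (C : ℤ →+* ℤ⟦X⟧), map_add, coeff_C_mul]
    rcases n with _ | n
    · simp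
    · simp [coeff_succ_X_mul, coeff_one, pow_succ']
  have hdvd : (X : ℤ⟦X⟧) ^ (N + 1) ∣ -X * (PowerSeries.mk fun n => (-(b : ℤ)) ^ n) - ∑ j ∈ range N,
      (((b * (j + 1) + j).choose j : ℕ) : ℤ⟦X⟧) * fugacity b ^ (j + 1) := by
    rw [X_pow_dvd_iff]
    rintro (_ | n) hn
    · simp [fugacity]
    · rw [map_sub, coeff_sum_choose_mul_fugacity_pow b (by omega), neg_mul, map_neg,
        coeff_succ_X_mul, coeff_mk, sub_self]
  convert hdvd.mul_left (1 + (b : ℤ⟦X⟧) * X) using 1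
  linear_combination X * hG

theorem eq_zero_of_X_pow_dvd_sum (b N : ℕ) (e : ℕ → ℤ)
    (h : (X : ℤ⟦X⟧) ^ (N + 1) ∣ ∑ j ∈ range N, C (e j) * fugacity b ^ (j + 1)) :
    ∀ n < N, e n = 0 := by
  intro n
  induction n using Nat.strong_induction_on with
  | _ n ih =>
    intro hn
    have hc := X_pow_dvd_iff.1 h (n + 1) (by omega)
    rw [map_sum, sum_eq_single n, coeff_C_mul, coeff_fugacity_pow, if_pos le_rfl] at hc
    · simpa using hc
    · intro j _ hjn
      rw [coeff_C_mul, coeff_fugacity_pow]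
      split_ifs with hj
      · rw [ih j (by omega) (by omega), zero_mul]
      · rw [mul_zero]
    · exact fun h => absurd (mem_range.2 hn) h

theorem heapCount_singleton_succ (b m : ℕ) :
    heapCount b {0} (m + 1) = (b * (m + 1) + m).choose m := by
  have h1 := X_pow_dvd_correlation_sub b (fugacity_mul_pow b)
    (dvd_neg.2 (dvd_mul_right _ _) : X ∣ fugacity b) (m + 1 + 1) (S := {0})
    (L := -((m + 1 + 1 : ℕ) * b : ℤ)) (n := (m + 1 + 1) * b + (m + 1 + 1) * b + 1) (by
      simp only [mem_singleton, forall_eq]; push_cast; constructor <;> linarith)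
  rw [correlation_singleton _ _ (by simp; positivity) (by push_cast; nlinarith), sum_range_succ',
    heapCount_eq_zero_of_lt b (by simp : 0 < ({0} : Finset ℤ).card)] at h1
  have h2 := dvd_sub (X_pow_dvd_sum_choose b (m + 1)) h1
  have h3 : IsUnit (1 + (b : ℤ⟦X⟧) * X) := by
    rw [isUnit_iff_constantCoeff]; simp
  have h4 := eq_zero_of_X_pow_dvd_sum b (m + 1)
    (fun j => heapCount b {0} (j + 1) - (b * (j + 1) + j).choose j) (by
      rw [← h3.dvd_mul_left]
      convert h2 using 1
      simp only [map_sub, map_natCast, sub_mul, sum_sub_distrib]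
      simp
      ring) m (Nat.lt_succ_self m)
  exact_mod_cast sub_eq_zero.1 h4

end Coefficients

theorem isPyramid_iff_isHeap (b : ℕ) (P : Finset (ℤ × ℕ)) :
    IsPyramid (b + 1) P ↔ IsHeap b {0} P := by
  unfold IsPyramid IsHeap
  constructor
  · rintro ⟨h0, h1, h2, h3⟩
    refine ⟨fun s => ?_, fun h s t hs ht hne => ?_, fun h s hs => ?_⟩
    · rw [Finset.mem_singleton]
      exact ⟨fun hs => congrArg Prod.fst (h1 _ hs rfl), fun hs => hs ▸ h0⟩
    · have := h2 _ ht _ hs rfl fun h => hne (congrArg Prod.fst h)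
      push_cast at this
      exact Int.add_one_le_iff.1 this
    · obtain ⟨⟨t, k⟩, ht, rfl, hst⟩ := h3 _ hs (Nat.le_add_left 1 h)
      push_cast at hst
      exact ⟨t, ht, by simpa using hst⟩
  · rintro ⟨h1, h2, h3⟩
    refine ⟨(h1 0).2 (Finset.mem_singleton_self 0), ?_, ?_, ?_⟩
    · rintro ⟨s, _⟩ hs rfl
      rw [Finset.mem_singleton.1 ((h1 s).1 hs)]
    · rintro ⟨s, h⟩ hs ⟨t, _⟩ ht rfl hne
      have := h2 h t s ht hs fun hst => hne (by rw [hst])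
      push_cast
      exact Int.add_one_le_iff.2 this
    · rintro ⟨s, _ | h⟩ hs hh
      · exact absurd hh (Nat.not_succ_le_zero 0)
      · obtain ⟨t, ht, hst⟩ := h3 h s hs
        exact ⟨(t, h), ht, rfl, by simpa using hst⟩

/-- The number of pyramids of size `m` built from pieces of length `a ≥ 2`
equals `C(a·m − 1, m − 1)`. -/
theorem pyramid_count (a m : ℕ) (ha : 2 ≤ a) (hm : 1 ≤ m) :
    Nat.card {P : Finset (ℤ × ℕ) // IsPyramid a P ∧ P.card = m} =
      Nat.choose (a * m - 1) (m - 1) := by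
  obtain ⟨b, rfl⟩ : ∃ b, a = b + 1 := ⟨a - 1, by omega⟩
  obtain ⟨m, rfl⟩ : ∃ k, m = k + 1 := ⟨m - 1, by omega⟩
  simp only [isPyramid_iff_isHeap]
  rw [show (b + 1) * (m + 1) - 1 = b * (m + 1) + m by rw [Nat.succ_mul]; omega,
    Nat.add_sub_cancel]
  exact heapCount_singleton_succ b m
end

section
/- Let a = 2 and let m ≥ 1 be an integer. The set of pyramids of size m and the set of (2m, m)-strings whose first entry is 1 have the same cardinality; in particular the number of pyramids of size m equals C(2m − 1, m − 1). -/
/-- An `(n, m)`-string: a sequence of `0`s and `1`s of length `n` (modelled as a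
function `ℕ → Bool` vanishing from position `n` on) with exactly `m` ones. -/
def IsString (n m : ℕ) (x : ℕ → Bool) : Prop :=
  (∀ u, n ≤ u → x u = false) ∧
    ((Finset.range n).filter (fun u => x u = true)).card = m

open PowerSeries

/-- A set of positions no two of which are at distance one. -/
def Sparse (A : Finset ℤ) : Prop :=
  ∀ s ∈ A, ∀ t ∈ A, s < t → s + 2 ≤ t

/-- The positions at distance at most one from `A`. -/
noncomputable def near (A : Finset ℤ) : Finset ℤ :=
  A.biUnion fun s => Finset.Icc (s - 1) (s + 1)

theorem mem_near {A : Finset ℤ} {t : ℤ} : t ∈ near A ↔ ∃ s ∈ A, s - 1 ≤ t ∧ t ≤ s + 1 := by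
  simp [near]

theorem near_empty : near ∅ = ∅ := rfl

theorem near_singleton (s : ℤ) : near {s} = Finset.Icc (s - 1) (s + 1) := by
  simp [near]

open Classical in
/-- The sparse subsets of `U`. -/
noncomputable def sparseSets (U : Finset ℤ) : Finset (Finset ℤ) :=
  U.powerset.filter Sparse

theorem mem_sparseSets {U A : Finset ℤ} : A ∈ sparseSets U ↔ A ⊆ U ∧ Sparse A := by
  simp [sparseSets]

theorem Sparse.mono {A B : Finset ℤ} (hA : Sparse A) (h : B ⊆ A) : Sparse B :=
  fun s hs t ht => hA s (h hs) t (h ht)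

/-- The alternating generating function of the sparse subsets of `U`, by size. -/
noncomputable def sparseSeries (U : Finset ℤ) : ℚ⟦X⟧ :=
  ∑ C ∈ sparseSets U, (-X) ^ C.card

theorem sparseSets_empty : sparseSets ∅ = {∅} := by
  ext A
  simp only [mem_sparseSets, Finset.subset_empty, Finset.mem_singleton, and_iff_left_iff_imp]
  rintro rfl
  simp [Sparse]

theorem sparseSeries_empty : sparseSeries ∅ = 1 := by
  simp [sparseSeries, sparseSets_empty]

theorem constantCoeff_sparseSeries (U : Finset ℤ) : constantCoeff (sparseSeries U) = 1 := by
  have h : ∅ ∈ sparseSets U := by simp [mem_sparseSets, Sparse]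
  rw [sparseSeries, map_sum, Finset.sum_eq_single_of_mem ∅ h]
  · simp
  · intro C _ hC
    simp [Finset.card_ne_zero.2 (Finset.nonempty_iff_ne_empty.2 hC)]

theorem sparseSeries_mul_inv (U : Finset ℤ) : sparseSeries U * (sparseSeries U)⁻¹ = 1 :=
  PowerSeries.mul_inv_cancel _ (by simp [constantCoeff_sparseSeries])

theorem sum_sparseSets_pow_mul_sparseSeries {S V : Finset ℤ} (hSV : S ⊆ V) :
    ∑ B ∈ sparseSets S, X ^ B.card * sparseSeries (V \ near B) = sparseSeries (V \ S) := by
  have hR : sparseSeries (V \ S) = ∑ E ∈ sparseSets V, ∑ B ∈ (E ∩ S).powerset,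
      (-X : ℚ⟦X⟧) ^ E.card * (-1) ^ B.card := by
    have hinner (E : Finset ℤ) : ∑ B ∈ (E ∩ S).powerset, (-1 : ℚ⟦X⟧) ^ B.card =
        if E ∩ S = ∅ then 1 else 0 := by
      have := congrArg (Int.cast : ℤ → ℚ⟦X⟧) (Finset.sum_powerset_neg_one_pow_card (x := E ∩ S))
      simpa using this
    simp_rw [← Finset.mul_sum, hinner, mul_ite, mul_one, mul_zero]
    rw [← Finset.sum_filter, sparseSeries]
    refine Finset.sum_congr ?_ fun _ _ => rfl
    ext E
    simp only [mem_sparseSets, Finset.mem_filter, Finset.subset_sdiff,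
      Finset.disjoint_iff_inter_eq_empty]
    tauto
  rw [hR]
  simp_rw [sparseSeries, Finset.mul_sum]
  rw [Finset.sum_sigma', Finset.sum_sigma']
  refine Finset.sum_bij' (fun p _ => ⟨p.1 ∪ p.2, p.1⟩) (fun q _ => ⟨q.2, q.1 \ q.2⟩) ?_ ?_ ?_ ?_ ?_
  · rintro ⟨B, C⟩ h
    simp only [Finset.mem_sigma, mem_sparseSets, Finset.mem_powerset] at h ⊢
    obtain ⟨⟨hBS, hB⟩, hCV, hC⟩ := h
    have hfar : ∀ t ∈ C, t ∈ V ∧ ∀ s ∈ B, ¬ (s - 1 ≤ t ∧ t ≤ s + 1) := by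
      intro t ht
      have := hCV ht
      simpa [mem_near] using this
    refine ⟨⟨Finset.union_subset (hBS.trans hSV) fun t ht => (hfar t ht).1, ?_⟩,
      Finset.subset_inter Finset.subset_union_left hBS⟩
    intro s hs t ht hst
    rcases Finset.mem_union.1 hs with hs | hs <;> rcases Finset.mem_union.1 ht with ht | ht
    · exact hB s hs t ht hst
    · have := (hfar t ht).2 s hs
      omega
    · have := (hfar s hs).2 t ht
      omega
    · exact hC s hs t ht hst
  · rintro ⟨E, B⟩ h
    simp only [Finset.mem_sigma, mem_sparseSets, Finset.mem_powerset, Finset.subset_inter_iff]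
      at h ⊢
    obtain ⟨⟨hEV, hE⟩, hBE, hBS⟩ := h
    refine ⟨⟨hBS, hE.mono hBE⟩, ?_, hE.mono Finset.sdiff_subset⟩
    intro t ht
    obtain ⟨htE, htB⟩ := Finset.mem_sdiff.1 ht
    refine Finset.mem_sdiff.2 ⟨hEV htE, fun hn => ?_⟩
    obtain ⟨s, hs, h1, h2⟩ := mem_near.1 hn
    have hne : s ≠ t := fun h => htB (h ▸ hs)
    have h3 := hE s (hBE hs) t htE
    have h4 := hE t htE s (hBE hs)
    omega
  · rintro ⟨B, C⟩ h
    simp only [Finset.mem_sigma, mem_sparseSets] at h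
    have hd : Disjoint B C := by
      rw [Finset.disjoint_left]
      intro t htB htC
      have := (Finset.mem_sdiff.1 (h.2.1 htC)).2
      exact this (mem_near.2 ⟨t, htB, by omega, by omega⟩)
    simp [Finset.union_sdiff_cancel_left hd]
  · rintro ⟨E, B⟩ h
    simp only [Finset.mem_sigma, Finset.mem_powerset, Finset.subset_inter_iff] at h
    simp [Finset.union_sdiff_of_subset h.2.1]
  · rintro ⟨B, C⟩ h
    simp only [Finset.mem_sigma, mem_sparseSets] at h
    have hd : Disjoint B C := by
      rw [Finset.disjoint_left]
      intro t htB htC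
      have := (Finset.mem_sdiff.1 (h.2.1 htC)).2
      exact this (mem_near.2 ⟨t, htB, by omega, by omega⟩)
    simp only [Finset.card_union_of_disjoint hd, pow_add]
    rw [mul_right_comm, ← mul_pow]
    simp

theorem sparseSeries_insert {s : ℤ} {U : Finset ℤ} (hs : s ∉ U) :
    sparseSeries (insert s U) =
      sparseSeries U - X * sparseSeries (U \ Finset.Icc (s - 1) (s + 1)) := by
  have h := sum_sparseSets_pow_mul_sparseSeries (S := {s}) (V := insert s U) (by simp)
  have hset : sparseSets {s} = {∅, {s}} := by
    ext A
    simp only [mem_sparseSets, Finset.subset_singleton_iff, Finset.mem_insert,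
      Finset.mem_singleton, and_iff_left_iff_imp]
    rintro (rfl | rfl) <;> simp [Sparse]
  have hU : insert s U \ {s} = U := by simp [Finset.sdiff_singleton_eq_erase, hs]
  have hN : insert s U \ Finset.Icc (s - 1) (s + 1) = U \ Finset.Icc (s - 1) (s + 1) :=
    Finset.insert_sdiff_of_mem _ (by simp)
  rw [hset, hU, Finset.sum_pair (Finset.singleton_ne_empty s).symm, near_empty, near_singleton,
    hN] at h
  simp only [Finset.card_empty, pow_zero, one_mul, Finset.sdiff_empty, Finset.card_singleton,
    pow_one] at h
  rw [← h]
  ring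

/-- The alternating generating function of the sparse subsets of `n` consecutive positions. -/
noncomputable def pathSeries : ℕ → ℚ⟦X⟧
  | 0 => 1
  | 1 => 1 - X
  | n + 2 => pathSeries (n + 1) - X * pathSeries n

theorem sparseSeries_Ico_union (a : ℤ) (n : ℕ) (R : Finset ℤ)
    (hR : ∀ r ∈ R, r + 2 ≤ a ∨ a + n < r) :
    sparseSeries (Finset.Ico a (a + n) ∪ R) = pathSeries n * sparseSeries R := by
  induction n using Nat.strong_induction_on with
  | _ n ih =>
    match n, ih, hR with
    | 0, _, _ => simp [pathSeries]
    | 1, _, hR =>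
      have h1 : Finset.Ico a (a + (1 : ℕ)) ∪ R = insert a R := by
        ext t
        simp only [Finset.mem_union, Finset.mem_Ico, Finset.mem_insert]
        refine or_congr_left ?_
        omega
      have h2 : R \ Finset.Icc (a - 1) (a + 1) = R := by
        refine Finset.sdiff_eq_self_of_disjoint (Finset.disjoint_left.2 fun r hr hr' => ?_)
        have := hR r hr
        rw [Finset.mem_Icc] at hr'
        omega
      have h3 : a ∉ R := fun h => by
        have := hR a h
        omega
      rw [h1, sparseSeries_insert h3, h2, pathSeries]
      ring
    | n + 2, ih, hR =>
      have h1 : Finset.Ico a (a + (n + 2 : ℕ)) ∪ R =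
          insert (a + n + 1) (Finset.Ico a (a + (n + 1 : ℕ)) ∪ R) := by
        ext t
        simp only [Finset.mem_union, Finset.mem_Ico, Finset.mem_insert, ← or_assoc]
        refine or_congr_left ?_
        omega
      have h2 : (Finset.Ico a (a + (n + 1 : ℕ)) ∪ R) \
          Finset.Icc (a + n + 1 - 1) (a + n + 1 + 1) = Finset.Ico a (a + n) ∪ R := by
        ext t
        simp only [Finset.mem_union, Finset.mem_Ico, Finset.mem_sdiff, Finset.mem_Icc]
        by_cases ht : t ∈ R
        · simp only [ht, or_true, true_and, iff_true]
          have := hR t ht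
          omega
        · simp only [ht, or_false]
          omega
      have h3 : a + n + 1 ∉ Finset.Ico a (a + (n + 1 : ℕ)) ∪ R := by
        intro h
        rcases Finset.mem_union.1 h with h | h
        · rw [Finset.mem_Ico] at h
          omega
        · have := hR _ h
          omega
      rw [h1, sparseSeries_insert h3, h2, ih (n + 1) (by omega), ih n (by omega), pathSeries]
      · ring
      · intro r hr
        have := hR r hr
        omega
      · intro r hr
        have := hR r hr
        omega

theorem sparseSeries_Ico (a : ℤ) (n : ℕ) :
    sparseSeries (Finset.Ico a (a + n)) = pathSeries n := by
  simpa [sparseSeries_empty] using sparseSeries_Ico_union a n ∅ (by simp)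

/-- A finite stack of dimers with bottom row `A`. -/
structure IsTower (A : Finset ℤ) (P : Finset (ℤ × ℕ)) : Prop where
  base : ∀ s, (s, 0) ∈ P ↔ s ∈ A
  separated : ∀ h s t, (s, h) ∈ P → (t, h) ∈ P → s < t → s + 2 ≤ t
  supported : ∀ h s, (s, h + 1) ∈ P → ∃ t, (t, h) ∈ P ∧ t - 1 ≤ s ∧ s ≤ t + 1

/-- Moving a piece up by one level. -/
def raise : ℤ × ℕ ↪ ℤ × ℕ where
  toFun p := (p.1, p.2 + 1)
  inj' := by
    rintro ⟨s, h⟩ ⟨t, k⟩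
    simp

theorem raise_apply (p : ℤ × ℕ) : raise p = (p.1, p.2 + 1) := rfl

/-- Putting the stack `Q` on top of the row `A`. -/
def lift (A : Finset ℤ) (Q : Finset (ℤ × ℕ)) : Finset (ℤ × ℕ) :=
  A.map (Function.Embedding.sectL ℤ 0) ∪ Q.map raise

theorem mem_lift_zero {A : Finset ℤ} {Q : Finset (ℤ × ℕ)} {s : ℤ} :
    (s, 0) ∈ lift A Q ↔ s ∈ A := by
  simp [lift, raise_apply]

theorem mem_lift_succ {A : Finset ℤ} {Q : Finset (ℤ × ℕ)} {s : ℤ} {h : ℕ} :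
    (s, h + 1) ∈ lift A Q ↔ (s, h) ∈ Q := by
  simp [lift, raise_apply]

theorem lift_injective (A : Finset ℤ) : Function.Injective (lift A) := by
  intro Q Q' h
  ext ⟨s, k⟩
  rw [← mem_lift_succ (A := A), h, mem_lift_succ]

theorem card_lift (A : Finset ℤ) (Q : Finset (ℤ × ℕ)) :
    (lift A Q).card = Q.card + A.card := by
  rw [lift, Finset.card_union_of_disjoint, Finset.card_map, Finset.card_map, add_comm]
  rw [Finset.disjoint_left]
  simp [raise_apply]

theorem IsTower.exists_lift {A : Finset ℤ} {P : Finset (ℤ × ℕ)} (hP : IsTower A P) :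
    ∃ Q, lift A Q = P := by
  refine ⟨P.preimage raise raise.injective.injOn, ?_⟩
  ext ⟨s, _ | h⟩
  · rw [mem_lift_zero, hP.base]
  · rw [mem_lift_succ, Finset.mem_preimage]
    rfl

theorem isTower_lift {A : Finset ℤ} (hA : Sparse A) {Q : Finset (ℤ × ℕ)} :
    IsTower A (lift A Q) ↔ ∃ B ∈ sparseSets (near A), IsTower B Q := by
  constructor
  · intro hP
    refine ⟨(Q.filter fun p => p.2 = 0).image Prod.fst, ?_, ?_, ?_, ?_⟩
    · refine mem_sparseSets.2 ⟨?_, ?_⟩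
      · intro s hs
        have hs' : (s, 0) ∈ Q := by simpa using hs
        obtain ⟨t, ht, h⟩ := hP.supported 0 s (mem_lift_succ.2 hs')
        exact mem_near.2 ⟨t, mem_lift_zero.1 ht, h⟩
      · intro s hs t ht hst
        have hs' : (s, 0) ∈ Q := by simpa using hs
        have ht' : (t, 0) ∈ Q := by simpa using ht
        exact hP.separated 1 s t (mem_lift_succ.2 hs') (mem_lift_succ.2 ht') hst
    · simp
    · intro h s t hs ht
      exact hP.separated (h + 1) s t (mem_lift_succ.2 hs) (mem_lift_succ.2 ht)
    · intro h s hs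
      obtain ⟨t, ht, hst⟩ := hP.supported (h + 1) s (mem_lift_succ.2 hs)
      exact ⟨t, mem_lift_succ.1 ht, hst⟩
  · rintro ⟨B, hB, hQ⟩
    refine ⟨fun _ => mem_lift_zero, ?_, ?_⟩
    · rintro (_ | h) s t hs ht
      · exact hA s (mem_lift_zero.1 hs) t (mem_lift_zero.1 ht)
      · exact hQ.separated h s t (mem_lift_succ.1 hs) (mem_lift_succ.1 ht)
    · rintro (_ | h) s hs
      · have hs' := (mem_sparseSets.1 hB).1 ((hQ.base s).1 (mem_lift_succ.1 hs))
        obtain ⟨t, ht, hst⟩ := mem_near.1 hs'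
        exact ⟨t, mem_lift_zero.2 ht, hst⟩
      · obtain ⟨t, ht, hst⟩ := hQ.supported h s (mem_lift_succ.1 hs)
        exact ⟨t, mem_lift_succ.2 ht, hst⟩

theorem isTower_empty {P : Finset (ℤ × ℕ)} : IsTower ∅ P ↔ P = ∅ := by
  constructor
  · intro hP
    have h : ∀ h s, (s, h) ∉ P := by
      intro h
      induction h with
      | zero => simp [hP.base]
      | succ h ih =>
        intro s hs
        obtain ⟨t, ht, _⟩ := hP.supported h s hs
        exact ih t ht
    exact Finset.eq_empty_of_forall_notMem fun p => h p.2 p.1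
  · rintro rfl
    exact ⟨by simp, by simp, by simp⟩

theorem IsTower.eq_base {A B : Finset ℤ} {P : Finset (ℤ × ℕ)} (hA : IsTower A P)
    (hB : IsTower B P) : A = B := by
  ext s
  rw [← hA.base, hB.base]

theorem exists_finset_isTower (N n k : ℕ) (hN : k + n ≤ N) (A : Finset ℤ) (hA : Sparse A)
    (hk : A ⊆ Finset.Icc (-k : ℤ) k) :
    ∃ T : Finset (Finset (ℤ × ℕ)), (∀ P, P ∈ T ↔ IsTower A P ∧ P.card = n) ∧
      (T.card : ℚ) = coeff n (X ^ A.card * sparseSeries (Finset.Icc (-N : ℤ) N \ near A) *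
        (sparseSeries (Finset.Icc (-N : ℤ) N))⁻¹) := by
  induction n using Nat.strong_induction_on generalizing k A with
  | _ n ih =>
    rcases A.eq_empty_or_nonempty with rfl | hne
    · refine ⟨if n = 0 then {∅} else ∅, ?_, ?_⟩
      · intro P
        rw [isTower_empty]
        split_ifs with hn
        · subst hn
          simp
        · simp only [Finset.notMem_empty, false_iff, not_and]
          rintro rfl h
          exact hn (by simpa using h.symm)
      · rw [near_empty, Finset.sdiff_empty, Finset.card_empty, pow_zero, one_mul,
          sparseSeries_mul_inv, coeff_one]
        split_ifs <;> simp
    have hpos := hne.card_pos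
    rw [mul_assoc, coeff_X_pow_mul']
    rcases lt_or_ge n A.card with hlt | hge
    · refine ⟨∅, ?_, by simp [hlt.not_ge]⟩
      intro P
      simp only [Finset.notMem_empty, false_iff, not_and]
      intro hP hn
      obtain ⟨Q, rfl⟩ := hP.exists_lift
      rw [card_lift] at hn
      omega
    have hnear : near A ⊆ Finset.Icc (-(k + 1 : ℕ) : ℤ) (k + 1 : ℕ) := by
      intro t ht
      obtain ⟨s, hs, hst⟩ := mem_near.1 ht
      have := hk hs
      rw [Finset.mem_Icc] at this ⊢
      omega
    have hnearN : near A ⊆ Finset.Icc (-N : ℤ) N :=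
      hnear.trans (Finset.Icc_subset_Icc (by omega) (by omega))
    have key : ∀ B ∈ sparseSets (near A), _ := fun B hB =>
      ih (n - A.card) (by omega) (k + 1) (by omega) B (mem_sparseSets.1 hB).2
        ((mem_sparseSets.1 hB).1.trans hnear)
    choose! T hT hcard using key
    refine ⟨((sparseSets (near A)).biUnion T).image (lift A), ?_, ?_⟩
    · intro P
      simp only [Finset.mem_image, Finset.mem_biUnion]
      constructor
      · rintro ⟨Q, ⟨B, hB, hQ⟩, rfl⟩
        have := (hT B hB Q).1 hQ
        refine ⟨(isTower_lift hA).2 ⟨B, hB, this.1⟩, ?_⟩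
        rw [card_lift, this.2]
        omega
      · rintro ⟨hP, hn⟩
        obtain ⟨Q, rfl⟩ := hP.exists_lift
        obtain ⟨B, hB, hQ⟩ := (isTower_lift hA).1 hP
        rw [card_lift] at hn
        exact ⟨Q, ⟨B, hB, (hT B hB Q).2 ⟨hQ, by omega⟩⟩, rfl⟩
    · rw [Finset.card_image_of_injective _ (lift_injective A), Finset.card_biUnion, if_pos hge,
        ← sum_sparseSets_pow_mul_sparseSeries hnearN, Finset.sum_mul, map_sum, Nat.cast_sum]
      · exact Finset.sum_congr rfl hcard
      · intro B hB C hC hBC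
        refine Finset.disjoint_left.2 fun Q hQB hQC => hBC ?_
        exact ((hT B hB Q).1 hQB).1.eq_base ((hT C hC Q).1 hQC).1

theorem isPyramid_two_iff {P : Finset (ℤ × ℕ)} : IsPyramid 2 P ↔ IsTower {0} P := by
  constructor
  · rintro ⟨h0, h1, h2, h3⟩
    refine ⟨fun s => ⟨fun hs => ?_, fun hs => ?_⟩, ?_, ?_⟩
    · simpa using h1 _ hs rfl
    · rw [Finset.mem_singleton.1 hs]
      exact h0
    · intro h s t hs ht hst
      have := h2 _ ht _ hs rfl (by simp [hst.ne'])
      rw [abs_of_pos (by simpa using hst)] at this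
      push_cast at this
      omega
    · intro h s hs
      obtain ⟨⟨t, k⟩, ht, hk, hst⟩ := h3 _ hs (by simp)
      obtain rfl : k = h := by simpa using hk
      refine ⟨t, ht, ?_⟩
      rw [abs_le] at hst
      push_cast at hst
      omega
  · intro hP
    refine ⟨(hP.base 0).2 (by simp), ?_, ?_, ?_⟩
    · rintro ⟨s, h⟩ hs (rfl : h = 0)
      simpa using (hP.base s).1 hs
    · rintro ⟨s, h⟩ hs ⟨t, k⟩ ht (rfl : h = k) hne
      have hst : s ≠ t := fun h => hne (by rw [h])
      have h1 := hP.separated h s t hs ht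
      have h2 := hP.separated h t s ht hs
      push_cast
      rw [le_abs]
      omega
    · rintro ⟨s, _ | h⟩ hs hh
      · simp at hh
      · obtain ⟨t, ht, hst⟩ := hP.supported h s hs
        refine ⟨(t, h), ht, rfl, ?_⟩
        push_cast
        rw [abs_le]
        omega

/-- The generating function of the central binomial coefficients. -/
noncomputable def centralBinomSeries : ℚ⟦X⟧ :=
  PowerSeries.mk fun n => (n.centralBinom : ℚ)

theorem constantCoeff_centralBinomSeries : constantCoeff centralBinomSeries = 1 := by
  rw [← coeff_zero_eq_constantCoeff_apply, centralBinomSeries, coeff_mk, Nat.centralBinom_zero,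
    Nat.cast_one]

theorem derivative_centralBinomSeries :
    d⁄dX ℚ centralBinomSeries * (1 - 4 * X) = 2 * centralBinomSeries := by
  have h4 : (4 : ℚ⟦X⟧) = C 4 := (map_ofNat C 4).symm
  have h2 : (2 : ℚ⟦X⟧) = C 2 := (map_ofNat C 2).symm
  rw [mul_sub, mul_one, h4, h2, mul_left_comm]
  ext n
  have hrec (n : ℕ) : ((n : ℚ) + 1) * (n + 1).centralBinom = 2 * (2 * n + 1) * n.centralBinom := by
    exact_mod_cast Nat.succ_mul_centralBinom_succ n
  rcases n with _ | n
  · rw [map_sub, coeff_C_mul, coeff_C_mul, coeff_zero_mul_X, coeff_derivative]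
    simp only [centralBinomSeries, coeff_mk]
    simpa using hrec 0
  · rw [map_sub, coeff_C_mul, coeff_C_mul, coeff_succ_mul_X, coeff_derivative, coeff_derivative]
    have := hrec (n + 1)
    simp only [centralBinomSeries, coeff_mk]
    push_cast at this ⊢
    linarith

theorem centralBinomSeries_sq_mul : centralBinomSeries ^ 2 * (1 - 4 * X) = 1 := by
  apply derivative.ext (R := ℚ)
  · have h := derivative_centralBinomSeries
    have h4 : d⁄dX ℚ (4 : ℚ⟦X⟧) = 0 := by
      rw [← map_ofNat C 4, derivative_C]
    rw [derivative_one, Derivation.leibniz, Derivation.leibniz_pow, map_sub, Derivation.leibniz,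
      derivative_X, derivative_one, h4]
    simp only [smul_eq_mul, nsmul_eq_mul]
    push_cast
    linear_combination 2 * centralBinomSeries * h
  · simp [constantCoeff_centralBinomSeries]

theorem pathSeries_mul {l u : ℚ⟦X⟧} (hadd : l + u = 1) (hmul : l * u = X) (n : ℕ) :
    (l - u) * pathSeries n = l ^ (n + 2) - u ^ (n + 2) := by
  induction n using Nat.strong_induction_on with
  | _ n ih =>
    match n, ih with
    | 0, _ =>
      rw [pathSeries]
      linear_combination (u - l) * hadd
    | 1, _ =>
      rw [pathSeries, ← hmul]
      obtain rfl : l = 1 - u := by linear_combination hadd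
      ring
    | n + 2, ih =>
      have h1 := ih (n + 1) (by omega)
      have h0 := ih n (by omega)
      rw [pathSeries, mul_sub, h1, mul_left_comm, h0, ← hmul]
      obtain rfl : l = 1 - u := by linear_combination hadd
      ring

theorem coeff_X_mul_pathSeries_sq (j : ℕ) :
    coeff (j + 1) (X * pathSeries j ^ 2 * (pathSeries (2 * j + 3))⁻¹) =
      ((2 * j + 1).choose j : ℚ) := by
  set B := centralBinomSeries with hB
  have hBsq : B ^ 2 * (1 - 4 * X) = 1 := centralBinomSeries_sq_mul
  have hC2 : (2 : ℚ⟦X⟧) * C (1 / 2 : ℚ) = 1 := by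
    rw [← map_ofNat C 2, ← map_mul]
    norm_num
  set w := C (1 / 2 : ℚ)
  set s := B * (1 - 4 * X)
  set l := w * (1 + s)
  set u := w * (1 - s)
  have hs : s * B = 1 := by linear_combination hBsq
  have hss : s ^ 2 = 1 - 4 * X := by linear_combination (1 - 4 * X) * hBsq
  have hadd : l + u = 1 := by linear_combination hC2
  have hsub : l - u = s := by linear_combination s * hC2
  have hmul : l * u = X := by
    linear_combination (-w ^ 2) * hss + (2 * w + 1) * X * hC2
  have hXu : X ∣ u := by
    rw [X_dvd_iff]
    simp [u, s, B, constantCoeff_centralBinomSeries]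
  have hp : constantCoeff (pathSeries (2 * j + 3)) = 1 := by
    rw [← sparseSeries_Ico 0, constantCoeff_sparseSeries]
  have hinv := PowerSeries.mul_inv_cancel (pathSeries (2 * j + 3)) (by simp [hp])
  have h1 := pathSeries_mul hadd hmul j
  have h3 := pathSeries_mul hadd hmul (2 * j + 3)
  rw [hsub] at h1 h3
  set p := pathSeries j
  set q := pathSeries (2 * j + 3)
  have hdvd : X ^ (j + 2) ∣ X * p ^ 2 * q⁻¹ - u * B := by
    obtain ⟨v, hv⟩ := hXu
    have hmain : s ^ 2 * (X * p ^ 2 - u * B * q) =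
        X ^ (j + 2) * (-2 * X + X * u ^ (j + 2) * v ^ (j + 2) + u ^ (j + 4) * v ^ (j + 2)) := by
      have e1 : s ^ 2 * (X * p ^ 2 - u * B * q) =
          X * (l ^ (j + 2) - u ^ (j + 2)) ^ 2 - u * (l ^ (2 * j + 5) - u ^ (2 * j + 5)) := by
        linear_combination X * (s * p + (l ^ (j + 2) - u ^ (j + 2))) * h1 - u * h3 -
          u * s * q * hs
      have e2 : X ^ (j + 2) * v ^ (j + 2) = u ^ (j + 2) := by rw [hv, mul_pow]
      have e3 : l ^ (j + 2) * u ^ (j + 2) = X ^ (j + 2) := by rw [← mul_pow, hmul]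
      rw [e1]
      linear_combination (-2 * X) * e3 - (X * u ^ (j + 2) + u ^ (j + 4)) * e2 -
        l ^ (2 * j + 4) * hmul
    refine ⟨B ^ 2 * q⁻¹ * (-2 * X + X * u ^ (j + 2) * v ^ (j + 2) +
      u ^ (j + 4) * v ^ (j + 2)), ?_⟩
    linear_combination B ^ 2 * q⁻¹ * hmain + u * B * hinv -
      (X * p ^ 2 * q⁻¹ - u * B * q * q⁻¹) * (s * B + 1) * hs
  have hco := (X_pow_dvd_iff.1 hdvd) (j + 1) (by omega)
  rw [map_sub, sub_eq_zero] at hco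
  have huB : u * B = w * (B - 1) := by linear_combination (-w) * hs
  rw [hco, huB, coeff_C_mul, map_sub, coeff_one, if_neg (by omega), hB, centralBinomSeries,
    coeff_mk, Nat.centralBinom, show 2 * (j + 1) = 2 * j + 1 + 1 by ring, Nat.choose_succ_succ,
    ← Nat.choose_symm_half]
  push_cast
  ring

theorem natCard_isPyramid_two (j : ℕ) :
    Nat.card {P : Finset (ℤ × ℕ) // IsPyramid 2 P ∧ P.card = j + 1} =
      (2 * j + 1).choose j := by
  obtain ⟨T, hT, hcard⟩ := exists_finset_isTower (j + 1) (j + 1) 0 (by omega) {0}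
    (by simp [Sparse]) (by simp)
  have hV : Finset.Icc (-(j + 1 : ℕ) : ℤ) (j + 1 : ℕ) =
      Finset.Ico (-(j + 1 : ℤ)) (-(j + 1 : ℤ) + (2 * j + 3 : ℕ)) := by
    ext t
    simp only [Finset.mem_Icc, Finset.mem_Ico]
    omega
  have hW : Finset.Icc (-(j + 1 : ℕ) : ℤ) (j + 1 : ℕ) \ near {0} =
      Finset.Ico (-(j + 1 : ℤ)) (-(j + 1 : ℤ) + j) ∪ Finset.Ico 2 (2 + (j : ℤ)) := by
    ext t
    simp only [near_singleton, Finset.mem_sdiff, Finset.mem_Icc, Finset.mem_Ico, Finset.mem_union]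
    omega
  rw [hW, sparseSeries_Ico_union, sparseSeries_Ico, hV, sparseSeries_Ico, Finset.card_singleton,
    pow_one, ← sq, coeff_X_mul_pathSeries_sq] at hcard
  · have hcard' : T.card = (2 * j + 1).choose j := by exact_mod_cast hcard
    rw [← hcard', ← Nat.card_eq_finsetCard]
    exact Nat.card_congr (Equiv.subtypeEquivRight fun P => by rw [hT, isPyramid_two_iff])
  · intro r hr
    rw [Finset.mem_Ico] at hr
    omega

theorem natCard_isString_head (j : ℕ) :
    Nat.card {x : ℕ → Bool // IsString (2 * (j + 1)) (j + 1) x ∧ x 0 = true} =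
      (2 * j + 1).choose j := by
  have hc : (2 * j + 1).choose j =
      Nat.card {S // S ∈ (Finset.Ico 1 (2 * j + 2)).powersetCard j} := by
    rw [Nat.card_eq_finsetCard, Finset.card_powersetCard, Nat.card_Ico]
    rfl
  rw [hc]
  have hsplit : Finset.range (2 * (j + 1)) = insert 0 (Finset.Ico 1 (2 * j + 2)) := by
    ext t
    simp only [Finset.mem_range, Finset.mem_insert, Finset.mem_Ico]
    omega
  have hcard (x : ℕ → Bool) (h0 : x 0 = true) :
      ((Finset.range (2 * (j + 1))).filter fun u => x u = true).card =
        ((Finset.Ico 1 (2 * j + 2)).filter fun u => x u = true).card + 1 := by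
    rw [hsplit, Finset.filter_insert, if_pos h0, Finset.card_insert_of_notMem (by simp)]
  refine Nat.card_congr
    { toFun := fun x => ⟨(Finset.Ico 1 (2 * j + 2)).filter fun u => x.1 u = true, ?_⟩
      invFun := fun S => ⟨fun u => decide (u = 0 ∨ u ∈ S.1), ?_⟩
      left_inv := ?_
      right_inv := ?_ }
  · obtain ⟨x, ⟨_, hx⟩, h0⟩ := x
    rw [hcard x h0] at hx
    exact Finset.mem_powersetCard.2 ⟨Finset.filter_subset _ _, by simpa using hx⟩
  · obtain ⟨S, hS⟩ := S
    obtain ⟨hS, hSc⟩ := Finset.mem_powersetCard.1 hS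
    refine ⟨⟨fun u hu => ?_, ?_⟩, by simp⟩
    · have : u ∉ S := fun h => by
        have := Finset.mem_Ico.1 (hS h)
        omega
      simp [this]
      omega
    · rw [hcard _ (by simp), add_left_inj]
      refine Eq.trans (congrArg Finset.card ?_) hSc
      ext u
      have := @hS u
      simp only [Finset.mem_filter, Finset.mem_Ico, decide_eq_true_eq] at this ⊢
      constructor
      · rintro ⟨h, rfl | h'⟩
        · omega
        · exact h'
      · exact fun h => ⟨this h, Or.inr h⟩
  · rintro ⟨x, ⟨hx, _⟩, h0⟩
    ext u
    rw [Bool.eq_iff_iff]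
    simp only [Finset.mem_filter, Finset.mem_Ico, decide_eq_true_eq]
    constructor
    · rintro (rfl | h)
      · exact h0
      · exact h.2
    · intro h
      have : ¬ 2 * (j + 1) ≤ u := fun hu => by simp [hx u hu] at h
      by_cases hu : u = 0
      · exact Or.inl hu
      · exact Or.inr ⟨by omega, h⟩
  · rintro ⟨S, hS⟩
    obtain ⟨hS, hSc⟩ := Finset.mem_powersetCard.1 hS
    ext u
    have := @hS u
    simp only [Finset.mem_filter, Finset.mem_Ico, decide_eq_true_eq] at this ⊢
    constructor
    · rintro ⟨h, rfl | h'⟩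
      · omega
      · exact h'
    · exact fun h => ⟨this h, Or.inr h⟩

/-- For `a = 2`: pyramids of size `m` are equinumerous with `(2m, m)`-strings
starting with `1`; in particular there are `C(2m − 1, m − 1)` of them. -/
theorem dimer_pyramid_count (m : ℕ) (hm : 1 ≤ m) :
    Nat.card {P : Finset (ℤ × ℕ) // IsPyramid 2 P ∧ P.card = m} =
      Nat.card {x : ℕ → Bool // IsString (2 * m) m x ∧ x 0 = true} ∧
    Nat.card {P : Finset (ℤ × ℕ) // IsPyramid 2 P ∧ P.card = m} =
      Nat.choose (2 * m - 1) (m - 1) := by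
  obtain ⟨j, rfl⟩ : ∃ j, m = j + 1 := ⟨m - 1, by omega⟩
  rw [natCard_isPyramid_two, natCard_isString_head]
  exact ⟨rfl, by rw [Nat.add_sub_cancel]; rfl⟩
end

section
/- Fix an integer a ≥ 2 and set t_0 = (a−1)^{a−1} / a^a. With A_m = (a·m)! / (m! · ((a−1)·m + 1)!), the series Σ_{m=1}^{∞} A_m · t_0^m converges and its sum equals 1/(a−1). -/
open Finset Nat

namespace FussCatalan

/-- The Fuss–Catalan number counting `(b + 1)`-ary trees with `m` internal nodes. -/
noncomputable def number (b m : ℕ) : ℝ :=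
  (((b + 1) * m).factorial : ℝ) / ((m.factorial : ℝ) * ((b * m + 1).factorial : ℝ))

theorem number_nonneg (b m : ℕ) : 0 ≤ number b m := by
  unfold number; positivity

theorem number_zero (b : ℕ) : number b 0 = 1 := by
  simp [number]

/-- The generating function of the Fuss–Catalan numbers. -/
noncomputable def genFun (b : ℕ) : PowerSeries ℝ := PowerSeries.mk (number b)

theorem number_mul_choose (b n d : ℕ) (hd : d ≤ n + 1) :
    number b d * ((b * d + 1).choose (n + 1 - d) : ℝ) =
      ((n + 1).choose d : ℝ) * (((b + 1) * d).descFactorial n : ℝ) / ((n + 1).factorial : ℝ) := by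
  have hsum : (b + 1) * d = b * d + d := by ring
  rcases Nat.lt_or_ge ((b + 1) * d) n with h | h
  · rw [Nat.descFactorial_eq_zero_iff_lt.2 h, Nat.choose_eq_zero_of_lt (by omega)]
    simp
  · have h₁ := Nat.choose_mul_factorial_mul_factorial (show n + 1 - d ≤ b * d + 1 by omega)
    have h₂ := Nat.choose_mul_factorial_mul_factorial hd
    have h₃ := Nat.factorial_mul_descFactorial h
    rw [show b * d + 1 - (n + 1 - d) = (b + 1) * d - n by omega] at h₁
    unfold number
    rw [← h₃, ← h₁, ← h₂]
    have hc : ((b * d + 1).choose (n + 1 - d) : ℝ) ≠ 0 := by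
      exact_mod_cast (Nat.choose_pos (show n + 1 - d ≤ b * d + 1 by omega)).ne'
    have hc' : ((n + 1).choose d : ℝ) ≠ 0 := by
      exact_mod_cast (Nat.choose_pos hd).ne'
    have hf (k : ℕ) : (k.factorial : ℝ) ≠ 0 := by exact_mod_cast k.factorial_ne_zero
    have := hf d
    have := hf (n + 1 - d)
    have := hf ((b + 1) * d - n)
    push_cast
    field_simp

theorem sum_choose_mul_descFactorial_eq_zero (b n : ℕ) :
    ∑ d ∈ range (n + 2),
      (-1 : ℝ) ^ d * (((n + 1).choose d : ℝ) * (((b + 1) * d).descFactorial n : ℝ)) = 0 := by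
  let P : Polynomial ℝ :=
    (descPochhammer ℝ n).comp (Polynomial.C ((b : ℝ) + 1) * Polynomial.X)
  have hP : P.natDegree < n + 1 := by
    have h₁ : P.natDegree ≤ _ := Polynomial.natDegree_comp_le
    have h₂ := (Polynomial.natDegree_C_mul_le ((b : ℝ) + 1) Polynomial.X).trans
      Polynomial.natDegree_X_le
    rw [descPochhammer_natDegree] at h₁
    nlinarith
  have h := congrFun (Polynomial.fwdDiff_iter_eq_zero_of_degree_lt hP) 0
  rw [fwdDiff_iter_eq_sum_shift] at h
  have hsign : ∀ d ∈ range (n + 2),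
      (-1 : ℝ) ^ d * (((n + 1).choose d : ℝ) * (((b + 1) * d).descFactorial n : ℝ)) =
        (-1) ^ (n + 1) *
          (((-1 : ℤ) ^ (n + 1 - d) * (n + 1).choose d) • P.eval (0 + d • (1 : ℝ))) := by
    intro d hd
    have hd : d ≤ n + 1 := by simpa [Nat.lt_succ_iff] using hd
    have heval : P.eval (0 + d • (1 : ℝ)) = (((b + 1) * d).descFactorial n : ℝ) := by
      rw [← descPochhammer_eval_eq_descFactorial]
      simp [P]
    obtain ⟨k, hk⟩ := Nat.exists_eq_add_of_le hd
    rw [heval, hk, Nat.add_sub_cancel_left, zsmul_eq_mul]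
    push_cast
    have : (-1 : ℝ) ^ k * (-1) ^ k = 1 := by rw [← mul_pow]; simp
    rw [pow_add]
    linear_combination (-(-1 : ℝ) ^ d * ((d + k).choose d : ℝ) *
      (((b + 1) * d).descFactorial n : ℝ)) * this
  rw [sum_congr rfl hsign, ← mul_sum, h]
  simp

theorem alternating_sum_number_mul_choose (b n : ℕ) :
    ∑ d ∈ range (n + 2),
      number b d * ((-1) ^ d * ((b * d + 1).choose (n + 1 - d) : ℝ)) = 0 := by
  have h : ∀ d ∈ range (n + 2),
      number b d * ((-1) ^ d * ((b * d + 1).choose (n + 1 - d) : ℝ)) =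
        (-1 : ℝ) ^ d * (((n + 1).choose d : ℝ) * (((b + 1) * d).descFactorial n : ℝ)) /
          ((n + 1).factorial : ℝ) := by
    intro d hd
    have := number_mul_choose b n d (by simpa [Nat.lt_succ_iff] using hd)
    rw [mul_div_assoc, ← this]
    ring
  rw [sum_congr rfl h, ← sum_div, sum_choose_mul_descFactorial_eq_zero, zero_div]

section FormalIdentity

open PowerSeries

theorem coeff_subst_eq_sum {F : ℝ⟦X⟧} (hF : constantCoeff F = 0) (f : ℝ⟦X⟧) {n N : ℕ}
    (hN : n < N) :
    coeff n (f.subst F) = ∑ d ∈ range N, coeff d f * coeff n (F ^ d) := by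
  rw [coeff_subst' (HasSubst.of_constantCoeff_zero' hF)]
  refine finsum_eq_sum_of_support_subset _ fun d hd ↦ ?_
  by_contra hd'
  refine hd ?_
  have hd' : n < d := by simp at hd'; omega
  simp [X_pow_dvd_iff.1 (pow_dvd_pow_of_dvd (X_dvd_iff.2 hF) d) n hd']

/-- The parametrisation under which `genFun b` becomes the inverse of `1 + X`. -/
noncomputable def param (b : ℕ) : ℝ⟦X⟧ := -(X * (1 + X) ^ b)

theorem constantCoeff_param (b : ℕ) : constantCoeff (param b) = 0 := by
  simp [param]

theorem coeff_param_pow_mul (b n d : ℕ) (hd : d ≤ n) :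
    coeff n (param b ^ d * (1 + X)) = (-1) ^ d * ((b * d + 1).choose (n - d) : ℝ) := by
  have h : param b ^ d * (1 + X) =
      C ((-1) ^ d) * (X ^ d * (((1 + Polynomial.X) ^ (b * d + 1) : Polynomial ℝ) : ℝ⟦X⟧)) := by
    rw [param, neg_pow]
    push_cast
    simp only [map_pow, map_neg, map_one]
    ring
  rw [h, coeff_C_mul, coeff_X_pow_mul', if_pos hd, Polynomial.coeff_coe,
    Polynomial.coeff_one_add_X_pow]

theorem subst_param_mul (b : ℕ) : (genFun b).subst (param b) * (1 + X) = 1 := by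
  ext n
  cases n with
  | zero =>
    have h := coeff_subst_eq_sum (constantCoeff_param b) (genFun b) (n := 0) zero_lt_one
    simp only [coeff_zero_eq_constantCoeff] at h ⊢
    rw [map_mul, h]
    simp [genFun, number_zero]
  | succ n =>
    rw [mul_add, mul_one, map_add, coeff_succ_mul_X,
      coeff_subst_eq_sum (constantCoeff_param b) _ (show n + 1 < n + 2 by omega),
      coeff_subst_eq_sum (constantCoeff_param b) _ (show n < n + 2 by omega),
      ← sum_add_distrib, coeff_one, if_neg n.succ_ne_zero,
      ← alternating_sum_number_mul_choose b n]
    refine sum_congr rfl fun d hd ↦ ?_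
    rw [← coeff_param_pow_mul b (n + 1) d (by simpa [Nat.lt_succ_iff] using hd), mul_add, mul_one,
      map_add, coeff_succ_mul_X, genFun, coeff_mk, mul_add]

theorem subst_param_injective (b : ℕ) :
    Function.Injective fun f : ℝ⟦X⟧ ↦ f.subst (param b) := by
  intro f g hfg
  have hunit : IsUnit (coeff 1 (param b)) := by
    simp [param]
  let := hunit.invertible
  have hc := constantCoeff_param b
  have hs := HasSubst.of_constantCoeff_zero' hc
  have h := congrArg (PowerSeries.subst (substInv (param b))) hfg
  simpa [subst_comp_subst_apply hs (HasSubst.substInv _), subst_substInv_right _ hc,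
    X_subst] using h

/-- The functional equation of the Fuss–Catalan generating function. -/
theorem genFun_eq (b : ℕ) : genFun b = 1 + X * genFun b ^ (b + 1) := by
  apply subst_param_injective b
  have hs := HasSubst.of_constantCoeff_zero' (constantCoeff_param b)
  have h := subst_param_mul b
  have h1 : (1 : ℝ⟦X⟧).subst (param b) = 1 := by
    rw [← coe_substAlgHom hs, map_one]
  simp only [subst_add hs, subst_mul hs, subst_pow hs, subst_X hs, h1]
  generalize (genFun b).subst (param b) = G at h ⊢
  have hpow : (1 + X) ^ b * G ^ b = 1 := by rw [← mul_pow, mul_comm, h, one_pow]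
  rw [param, pow_succ]
  linear_combination h + X * G * hpow

end FormalIdentity

section Evaluation

open PowerSeries

variable {f g : ℝ⟦X⟧} {t : ℝ}

theorem coeff_pow_nonneg (hf : ∀ n, 0 ≤ coeff n f) (k n : ℕ) : 0 ≤ coeff n (f ^ k) := by
  induction k generalizing n with
  | zero => rw [pow_zero, coeff_one]; split_ifs <;> norm_num
  | succ k ih =>
    rw [pow_succ, coeff_mul]
    exact sum_nonneg fun p _ ↦ mul_nonneg (ih _) (hf _)

theorem coeff_mul_mul_pow (f g : ℝ⟦X⟧) (t : ℝ) (n : ℕ) :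
    coeff n (f * g) * t ^ n =
      ∑ p ∈ antidiagonal n, (coeff p.1 f * t ^ p.1) * (coeff p.2 g * t ^ p.2) := by
  rw [coeff_mul, sum_mul]
  refine sum_congr rfl fun p hp ↦ ?_
  rw [← mem_antidiagonal.1 hp, pow_add]
  ring

theorem sum_range_coeff_mul_le (hf : ∀ n, 0 ≤ coeff n f) (hg : ∀ n, 0 ≤ coeff n g) (ht : 0 ≤ t)
    (N : ℕ) :
    ∑ n ∈ range N, coeff n (f * g) * t ^ n ≤
      (∑ n ∈ range N, coeff n f * t ^ n) * ∑ n ∈ range N, coeff n g * t ^ n := by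
  simp only [coeff_mul_mul_pow]
  rw [sum_mul_sum, ← sum_product']
  have hnonneg (p : ℕ × ℕ) : 0 ≤ coeff p.1 f * t ^ p.1 * (coeff p.2 g * t ^ p.2) :=
    mul_nonneg (mul_nonneg (hf _) (pow_nonneg ht _)) (mul_nonneg (hg _) (pow_nonneg ht _))
  refine le_trans (sum_le_sum fun n hn ↦ le_of_eq (sum_congr ?_ fun _ _ ↦ rfl))
    (sum_fiberwise_le_sum_of_sum_fiber_nonneg (t := range N) (g := fun p : ℕ × ℕ ↦ p.1 + p.2)
      fun n _ ↦ sum_nonneg fun p _ ↦ hnonneg p)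
  ext p
  simp only [HasAntidiagonal.mem_antidiagonal, mem_filter, mem_product, mem_range] at hn ⊢
  omega

theorem sum_range_coeff_pow_le (hf : ∀ n, 0 ≤ coeff n f) (ht : 0 ≤ t) (k N : ℕ) :
    ∑ n ∈ range N, coeff n (f ^ k) * t ^ n ≤ (∑ n ∈ range N, coeff n f * t ^ n) ^ k := by
  induction k with
  | zero =>
    simp only [pow_zero, coeff_one, ite_mul, one_mul, zero_mul]
    rw [sum_ite_eq']
    split_ifs <;> norm_num
  | succ k ih =>
    rw [pow_succ, pow_succ]
    exact (sum_range_coeff_mul_le (coeff_pow_nonneg hf k) hf ht N).trans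
      (mul_le_mul_of_nonneg_right ih
        (sum_nonneg fun n _ ↦ mul_nonneg (hf n) (pow_nonneg ht n)))

theorem hasSum_coeff_mul {x y : ℝ} (hx : HasSum (fun n ↦ coeff n f * t ^ n) x)
    (hy : HasSum (fun n ↦ coeff n g * t ^ n) y) :
    HasSum (fun n ↦ coeff n (f * g) * t ^ n) (x * y) := by
  simp only [coeff_mul_mul_pow]
  have hf' : Summable fun n ↦ ‖coeff n f * t ^ n‖ := hx.summable.norm
  have hg' : Summable fun n ↦ ‖coeff n g * t ^ n‖ := hy.summable.norm
  rw [← hx.tsum_eq, ← hy.tsum_eq,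
    tsum_mul_tsum_eq_tsum_sum_antidiagonal_of_summable_norm hf' hg']
  exact (summable_norm_sum_mul_antidiagonal_of_summable_norm hf' hg').of_norm.hasSum

theorem hasSum_coeff_pow {x : ℝ} (hx : HasSum (fun n ↦ coeff n f * t ^ n) x) (k : ℕ) :
    HasSum (fun n ↦ coeff n (f ^ k) * t ^ n) (x ^ k) := by
  induction k with
  | zero =>
    rw [pow_zero, pow_zero]
    convert hasSum_ite_eq (0 : ℕ) (1 : ℝ) using 2 with n
    rw [coeff_one]
    split_ifs with hn <;> simp [hn]
  | succ k ih =>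
    rw [pow_succ, pow_succ]
    exact hasSum_coeff_mul ih hx

end Evaluation

theorem number_succ (b m : ℕ) :
    number b (m + 1) = PowerSeries.coeff m (genFun b ^ (b + 1)) := by
  have h := congrArg (PowerSeries.coeff (m + 1)) (genFun_eq b)
  rw [map_add, PowerSeries.coeff_succ_X_mul, PowerSeries.coeff_one, if_neg m.succ_ne_zero,
    zero_add] at h
  rw [← h, genFun, PowerSeries.coeff_mk]

theorem coeff_genFun_nonneg (b n : ℕ) : 0 ≤ PowerSeries.coeff n (genFun b) := by
  simpa [genFun] using number_nonneg b n

theorem sum_range_number_le {b : ℕ} {t c : ℝ} (ht : 0 ≤ t) (hc : 1 + t * c ^ (b + 1) ≤ c)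
    (hc₀ : 0 ≤ c) (N : ℕ) : ∑ m ∈ range N, number b m * t ^ m ≤ c := by
  induction N with
  | zero => simpa
  | succ N ih =>
    have h : ∑ m ∈ range N, number b (m + 1) * t ^ (m + 1) =
        t * ∑ m ∈ range N, PowerSeries.coeff m (genFun b ^ (b + 1)) * t ^ m := by
      rw [mul_sum]
      refine sum_congr rfl fun m _ ↦ ?_
      rw [number_succ]
      ring
    have hle := sum_range_coeff_pow_le (coeff_genFun_nonneg b) ht (b + 1) N
    simp only [genFun, PowerSeries.coeff_mk] at hle h
    rw [sum_range_succ', h, number_zero]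
    have hpow : (∑ m ∈ range N, number b m * t ^ m) ^ (b + 1) ≤ c ^ (b + 1) :=
      pow_le_pow_left₀ (sum_nonneg fun m _ ↦ mul_nonneg (number_nonneg b m) (pow_nonneg ht m))
        ih _
    have := mul_le_mul_of_nonneg_left (hle.trans hpow) ht
    simp only [pow_zero, mul_one]
    linarith

theorem summable_number {b : ℕ} {t c : ℝ} (ht : 0 ≤ t) (hc : 1 + t * c ^ (b + 1) ≤ c)
    (hc₀ : 0 ≤ c) : Summable fun m ↦ number b m * t ^ m :=
  summable_of_sum_range_le (fun m ↦ mul_nonneg (number_nonneg b m) (pow_nonneg ht m))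
    (sum_range_number_le ht hc hc₀)

theorem hasSum_number_succ {b : ℕ} {t x : ℝ}
    (hx : HasSum (fun m ↦ number b m * t ^ m) x) :
    HasSum (fun m ↦ number b (m + 1) * t ^ (m + 1)) (t * x ^ (b + 1)) := by
  have hx' : HasSum (fun m ↦ PowerSeries.coeff m (genFun b) * t ^ m) x := by
    simpa [genFun] using hx
  have h (m : ℕ) : number b (m + 1) * t ^ (m + 1) =
      t * (PowerSeries.coeff m (genFun b ^ (b + 1)) * t ^ m) := by
    rw [number_succ]
    ring
  simpa only [h] using (hasSum_coeff_pow hx' (b + 1)).mul_left t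

theorem eq_of_eq_one_add_mul_pow {b : ℕ} (hb : 0 < b) {x : ℝ} (hx₀ : 0 ≤ x)
    (hx : x = 1 + (b : ℝ) ^ b / ((b : ℝ) + 1) ^ (b + 1) * x ^ (b + 1)) :
    x = ((b : ℝ) + 1) / b := by
  have hb' : (0 : ℝ) < b := by exact_mod_cast hb
  by_contra hne
  set s : ℝ := b * x / (b + 1) - 1 with hs
  have hs₁ : -1 ≤ s := by
    have : 0 ≤ (b : ℝ) * x / (b + 1) := by positivity
    linarith
  have hs₀ : s ≠ 0 := by
    intro h
    apply hne
    rw [hs] at h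
    field_simp at h ⊢
    linarith
  have hlt := one_add_mul_self_lt_rpow_one_add hs₁ hs₀
    (show (1 : ℝ) < ((b + 1 : ℕ) : ℝ) by push_cast; linarith)
  rw [Real.rpow_natCast] at hlt
  have hpow : (1 + s) ^ (b + 1) =
      b * ((b : ℝ) ^ b / ((b : ℝ) + 1) ^ (b + 1) * x ^ (b + 1)) := by
    rw [hs, add_sub_cancel, div_pow, mul_pow, pow_succ (b : ℝ)]
    ring
  rw [hpow] at hlt
  have hmul : ((b + 1 : ℕ) : ℝ) * s = b * x - (b + 1) := by
    rw [hs]; push_cast; field_simp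
  rw [hmul] at hlt
  have := congrArg ((b : ℝ) * ·) hx
  simp only [mul_add, mul_one] at this
  linarith

end FussCatalan


/-- With `t₀ = (a−1)^{a−1}/a^a` and the Fuss–Catalan numbers
`A_m = (a·m)! / (m! · ((a−1)·m + 1)!)`, the series `Σ_{m≥1} A_m·t₀^m` converges
with sum `1/(a−1)`. -/
theorem fussCatalan_series_at_radius (a : ℕ) (ha : 2 ≤ a) :
    HasSum
      (fun m : ℕ =>
        (((a * (m + 1)).factorial : ℝ) /
            (((m + 1).factorial : ℝ) * (((a - 1) * (m + 1) + 1).factorial : ℝ))) *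
          ((((a : ℝ) - 1) ^ (a - 1) / (a : ℝ) ^ a) ^ (m + 1)))
      (1 / ((a : ℝ) - 1)) := by
  obtain ⟨b, rfl⟩ : ∃ b, a = b + 1 := ⟨a - 1, by omega⟩
  have hb : 0 < b := by omega
  have hb' : (0 : ℝ) < b := by exact_mod_cast hb
  simp only [Nat.add_sub_cancel, Nat.cast_add, Nat.cast_one, add_sub_cancel_right]
  set t : ℝ := (b : ℝ) ^ b / ((b : ℝ) + 1) ^ (b + 1) with ht
  have ht₀ : 0 ≤ t := by positivity
  have hfix : 1 + t * (((b : ℝ) + 1) / b) ^ (b + 1) = ((b : ℝ) + 1) / b := by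
    rw [ht, div_pow, pow_succ (b : ℝ)]
    field_simp
  obtain ⟨x, hx⟩ := FussCatalan.summable_number ht₀ hfix.le (by positivity)
  have hsucc := FussCatalan.hasSum_number_succ hx
  have hx₀ : 0 ≤ x :=
    hx.nonneg fun m ↦ mul_nonneg (FussCatalan.number_nonneg b m) (pow_nonneg ht₀ m)
  have hxeq : x = 1 + t * x ^ (b + 1) := by
    have h := hsucc.unique ((hasSum_nat_add_iff' 1).2 hx)
    rw [sum_range_one, FussCatalan.number_zero, pow_zero, mul_one] at h
    rw [h, add_sub_cancel]
  have hval : t * x ^ (b + 1) = 1 / b := by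
    have h := FussCatalan.eq_of_eq_one_add_mul_pow hb hx₀ hxeq
    rw [eq_sub_of_add_eq' hxeq.symm, h]
    field_simp
    ring
  rw [← hval]
  exact hsucc
end
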